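/- Let G be a vertex-minimal triangle-free, fork-free graph with chromatic number at least 4, and let C be a 5-cycle in G minimizing the number of vertices at distance at least 2 from C (a good 5-cycle). If no vertex of G is at distance 3 or more from C, then the set of vertices at distance exactly 2 from C is not an independent set (it contains at least one edge). -/

import Mathlib

open SimpleGraph

/-- The fork: `K_{1,4}` with two edges subdivided. Vertex 0 is the center,
adjacent to leaves 1, 2 and to 3, 5; paths 0-3-4 and 0-5-6. -/
def fork : SimpleGraph (Fin 7) :=
  SimpleGraph.fromEdgeSet {s(0, 1), s(0, 2), s(0, 3), s(0, 5), s(3, 4), s(5, 6)}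

/-- A graph is fork-free if it has no induced subgraph isomorphic to the fork. -/
def ForkFree {V : Type} (G : SimpleGraph V) : Prop :=
  IsEmpty (fork ↪g G)

/-- `G` is a vertex-minimal triangle-free, fork-free graph with chromatic
number at least 4: every smaller triangle-free fork-free graph is 3-colorable. -/
def MinCex {V : Type} [Fintype V] (G : SimpleGraph V) : Prop :=
  G.CliqueFree 3 ∧ ForkFree G ∧ 4 ≤ G.chromaticNumber ∧
    ∀ (W : Type) [Fintype W] (H : SimpleGraph W),
      Fintype.card W < Fintype.card V → H.CliqueFree 3 → ForkFree H →
        H.chromaticNumber ≤ 3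

/-- `c` describes a 5-cycle in `G`. -/
def IsC5 {V : Type} (G : SimpleGraph V) (c : Fin 5 → V) : Prop :=
  Function.Injective c ∧ ∀ i : Fin 5, G.Adj (c i) (c (i + 1))

/-- Distance from a vertex `u` to the 5-cycle `c`. -/
noncomputable def distC {V : Type} (G : SimpleGraph V) (c : Fin 5 → V) (u : V) : ℕ :=
  Finset.univ.inf' Finset.univ_nonempty fun i => G.dist u (c i)

/-- A good 5-cycle: one minimizing the number of vertices at distance at least 2. -/
def GoodC5 {V : Type} (G : SimpleGraph V) (c : Fin 5 → V) : Prop :=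
  IsC5 G c ∧ ∀ d : Fin 5 → V, IsC5 G d →
    {u : V | 2 ≤ distC G c u}.ncard ≤ {u : V | 2 ≤ distC G d u}.ncard

namespace ForkAux

/-- even positions -/
def ev (p : Fin 10) : Prop := p.val % 2 = 0

instance (p : Fin 10) : Decidable (ev p) := inferInstanceAs (Decidable (_ = _))

/-- potential edges between positions on the 10-cycle of nodes -/
def pot (p q : Fin 10) : Prop :=
  (3 ≤ (p - q).val ∧ (p - q).val ≤ 7) ∨ (ev p ∧ ((p - q).val = 2 ∨ (p - q).val = 8))

instance (p q : Fin 10) : Decidable (pot p q) := inferInstanceAs (Decidable (_ ∨ _))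

structure Abs {W : Type} (ne : Fin 10 → Prop) (E : Fin 10 → Fin 10 → Prop)
    (S : W → Fin 10 → Prop) : Prop where
  Ene : ∀ p q, E p q → ne p
  Esymm : ∀ p q, E p q → E q p
  Epot : ∀ p q, E p q → pot p q
  Sne : ∀ w p, S w p → ne p
  Sadj1 : ∀ w p, S w p → ne (p + 1) → S w (p + 1)
  Sadj2 : ∀ w p, S w p → ne (p - 1) → S w (p - 1)
  SE : ∀ w p q, E p q → S w p → ¬ S w q
  link1 : ∀ p, ev p → E p (p + 2) → ¬ ne (p + 1)
  linkT : ∀ p, ev p → E p (p + 2) → E (p + 2) (p + 4) → ¬ E p (p + 4)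
  h1 : ∀ p, ev p → E p (p + 2) → E p (p - 2) → ¬ E p (p + 3) ∧ ¬ E p (p - 3)
  h2 : ∀ p, ev p → E p (p + 2) → E p (p - 2) → ne (p + 4) → ne (p - 4) →
    ¬ (E (p + 5) (p + 2) ∧ E (p + 5) (p - 2))
  opp : ∀ w p, ev p → S w p → S w (p + 5) → ¬ ne (p + 4) ∧ ¬ ne (p - 4)
  e4 : ∀ w p, ev p → S w p → S w (p + 4) → ¬ ne (p - 1) ∧ ¬ ne (p + 5)
  gd : ∀ w p, ¬ ev p → S w p → ne (p + 5)
  dom : ∀ w p, ev p → ∃ q, S w q ∧ q ≠ p - 1 ∧ q ≠ p ∧ q ≠ p + 1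
  inc : ∀ w w', w ≠ w' → ∃ p, S w p ∧ ¬ S w' p

def Good {W : Type} (ne : Fin 10 → Prop) (E : Fin 10 → Fin 10 → Prop)
    (S : W → Fin 10 → Prop) : Prop :=
  ∃ col cc : Fin 10 → Fin 3,
    (∀ p, ev p → cc p ≠ cc (p + 4)) ∧
    (∀ p, ev p → (ne p → cc p ≠ col p) ∧ (ne (p + 1) → cc p ≠ col (p + 1)) ∧
      (ne (p - 1) → cc p ≠ col (p - 1))) ∧
    (∀ p q, E p q → col p ≠ col q) ∧ (∀ w, ∃ k, ∀ p, S w p → col p ≠ k)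

section
variable {W : Type} {ne : Fin 10 → Prop} {E : Fin 10 → Fin 10 → Prop} {S : W → Fin 10 → Prop}

theorem Abs.shift (h : Abs ne E S) (k : Fin 10) (hk : ev k) :
    Abs (fun p => ne (p + k)) (fun p q => E (p + k) (q + k)) (fun w p => S w (p + k)) := by
  have hev : ∀ p : Fin 10, ev (p + k) ↔ ev p := by revert hk; revert k; decide
  have a : ∀ p m : Fin 10, p + m + k = p + k + m := fun p m => add_right_comm p m k
  have b : ∀ p m : Fin 10, p - m + k = p + k - m := fun p m => by
    rw [sub_eq_add_neg, sub_eq_add_neg, add_right_comm]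
  have hinj : ∀ p q : Fin 10, p + k = q + k ↔ p = q := fun p q => add_left_inj k
  constructor <;> try simp only [a, b]
  · exact fun p q => h.Ene _ _
  · exact fun p q => h.Esymm _ _
  · intro p q e
    have := h.Epot _ _ e
    have hp : (p + k) - (q + k) = p - q := add_sub_add_right_eq_sub p q k
    unfold pot at this ⊢
    rwa [hp, hev] at this
  · exact fun w p => h.Sne _ _
  · exact fun w p => h.Sadj1 _ _
  · exact fun w p => h.Sadj2 _ _
  · exact fun w p q => h.SE _ _ _
  · exact fun p e => h.link1 _ ((hev p).2 e)
  · exact fun p e => h.linkT _ ((hev p).2 e)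
  · exact fun p e => h.h1 _ ((hev p).2 e)
  · exact fun p e => h.h2 _ ((hev p).2 e)
  · exact fun w p e => h.opp _ _ ((hev p).2 e)
  · exact fun w p e => h.e4 _ _ ((hev p).2 e)
  · exact fun w p e => h.gd _ _ (fun h' => e ((hev p).1 h'))
  · intro w p e
    obtain ⟨q, hq, q1, q2, q3⟩ := h.dom w _ ((hev p).2 e)
    refine ⟨q - k, by simpa using hq, ?_, ?_, ?_⟩
    · rintro rfl'
      exact q1 (by rw [← b, ← rfl', sub_add_cancel])
    · rintro rfl'
      exact q2 (by rw [← rfl', sub_add_cancel])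
    · rintro rfl'
      exact q3 (by rw [← a, ← rfl', sub_add_cancel])
  · intro w w' e
    obtain ⟨q, hq, hq'⟩ := h.inc w w' e
    exact ⟨q - k, by simpa using hq, by simpa using hq'⟩

theorem Abs.neg (h : Abs ne E S) :
    Abs (fun p => ne (-p)) (fun p q => E (-p) (-q)) (fun w p => S w (-p)) := by
  have hev : ∀ p : Fin 10, ev (-p) ↔ ev p := by decide
  have a : ∀ p m : Fin 10, -(p + m) = -p - m := fun p m => neg_add' p m
  have b : ∀ p m : Fin 10, -(p - m) = -p + m := by decide
  constructor <;> try simp only [a, b]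
  · exact fun p q => h.Ene _ _
  · exact fun p q => h.Esymm _ _
  · intro p q e
    have := h.Epot _ _ e
    clear * - this; revert this; revert p q; decide
  · exact fun w p => h.Sne _ _
  · exact fun w p => h.Sadj2 _ _
  · exact fun w p => h.Sadj1 _ _
  · exact fun w p q => h.SE _ _ _
  · intro p e l
    have := h.link1 (-p - 2) (by clear * - e; revert e; revert p; decide)
    rw [show -p - 2 + 2 = -p by clear * -; revert p; decide, show -p - 2 + 1 = -p - 1 by clear * -; revert p; decide]
      at this
    exact this (h.Esymm _ _ l)
  · intro p e l1 l2 l3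
    have := h.linkT (-p - 4) (by clear * - e; revert e; revert p; decide)
    rw [show -p - 4 + 2 = -p - 2 by clear * -; revert p; decide, show -p - 4 + 4 = -p by clear * -; revert p; decide]
      at this
    exact this (h.Esymm _ _ l2) (h.Esymm _ _ l1) (h.Esymm _ _ l3)
  · exact fun p e l1 l2 => (h.h1 _ ((hev p).2 e) l2 l1).symm
  · intro p e l1 l2 n1 n2 l3
    have := h.h2 _ ((hev p).2 e) l2 l1 n2 n1
    rw [show -p + 5 = -p - 5 by clear * -; revert p; decide] at this
    exact this l3.symm
  · intro w p e s1 s2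
    rw [show -p - 5 = -p + 5 by clear * -; revert p; decide] at s2
    exact (h.opp _ _ ((hev p).2 e) s1 s2).symm
  · intro w p e s1 s2
    have := h.e4 w (-p - 4) (by clear * - e; revert e; revert p; decide) s2
    rw [show -p - 4 + 4 = -p by clear * -; revert p; decide, show -p - 4 - 1 = -p - 5 by clear * -; revert p; decide,
      show -p - 4 + 5 = -p + 1 by clear * -; revert p; decide] at this
    exact (this s1).symm
  · intro w p e s
    rw [show -p - 5 = -p + 5 by clear * -; revert p; decide]
    exact h.gd _ _ (fun h' => e ((hev p).1 h')) s
  · intro w p e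
    obtain ⟨q, hq, q1, q2, q3⟩ := h.dom w _ ((hev p).2 e)
    refine ⟨-q, by simpa using hq, ?_, ?_, ?_⟩
    · revert q3; clear hq; revert p q; decide
    · revert q2; clear hq; revert p q; decide
    · revert q1; clear hq; revert p q; decide
  · intro w w' e
    obtain ⟨q, hq, hq'⟩ := h.inc w w' e
    exact ⟨-q, by simpa using hq, by simpa using hq'⟩

theorem Good.of_shift (k : Fin 10) (hk : ev k)
    (h : Good (fun p => ne (p + k)) (fun p q => E (p + k) (q + k)) (fun w p => S w (p + k))) :
    Good ne E S := by
  obtain ⟨col, cc, g1, g2, g3, g4⟩ := h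
  have hev : ∀ p : Fin 10, ev (p - k) ↔ ev p := by clear * - hk; revert hk; revert k; decide
  have a : ∀ p m : Fin 10, p + m - k = p - k + m := by clear * -; intro p m; abel
  have b : ∀ p m : Fin 10, p - m - k = p - k - m := by clear * -; intro p m; abel
  have c : ∀ p m : Fin 10, p - k + m + k = p + m := by clear * -; intro p m; abel
  have d : ∀ p m : Fin 10, p - k - m + k = p - m := by clear * -; intro p m; abel
  refine ⟨fun p => col (p - k), fun p => cc (p - k), ?_, ?_, ?_, ?_⟩
  · intro p e
    simp only [a]
    exact g1 _ ((hev p).2 e)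
  · intro p e
    have := g2 _ ((hev p).2 e)
    simpa only [a, b, c, d, sub_add_cancel] using this
  · intro p q e
    apply g3
    simpa using e
  · intro w
    obtain ⟨x, hx⟩ := g4 w
    exact ⟨x, fun p hp => hx _ (by simpa using hp)⟩

theorem Good.of_neg
    (h : Good (fun p => ne (-p)) (fun p q => E (-p) (-q)) (fun w p => S w (-p))) :
    Good ne E S := by
  obtain ⟨col, cc, g1, g2, g3, g4⟩ := h
  have hev : ∀ p : Fin 10, ev (-p) ↔ ev p := by decide
  refine ⟨fun p => col (-p), fun p => cc (-p), ?_, ?_, ?_, ?_⟩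
  · intro p e
    have := g1 (-p - 4) (by clear * - e; revert e; revert p; decide)
    rw [show -p - 4 + 4 = -p by clear * -; revert p; decide] at this
    have e2 : -(p + 4) = -p - 4 := by clear * -; revert p; decide
    simp only [e2]
    exact this.symm
  · intro p e
    have e1 : -(-p + 1) = p - 1 := by clear * -; revert p; decide
    have e2 : -(-p - 1) = p + 1 := by clear * -; revert p; decide
    have e3 : -(p + 1) = -p - 1 := by clear * -; revert p; decide
    have e4 : -(p - 1) = -p + 1 := by clear * -; revert p; decide
    have := g2 _ ((hev p).2 e)
    simp only [neg_neg, e1, e2] at this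
    simp only [e3, e4]
    exact ⟨this.1, this.2.2, this.2.1⟩
  · intro p q e
    apply g3
    simpa using e
  · intro w
    obtain ⟨x, hx⟩ := g4 w
    exact ⟨x, fun p hp => hx _ (by simpa using hp)⟩

/-- decidable check for a node colouring -/
def ChkC (emp : List (Fin 10)) (col cc : Fin 10 → Fin 3) (p : Fin 10) : Prop :=
  cc p ≠ cc (p + 4) ∧ (p ∈ emp ∨ cc p ≠ col p) ∧ (p + 1 ∈ emp ∨ cc p ≠ col (p + 1)) ∧
    (p - 1 ∈ emp ∨ cc p ≠ col (p - 1))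

instance (emp col cc p) : Decidable (ChkC emp col cc p) := inferInstanceAs (Decidable (_ ∧ _))

def ChkE (emp : List (Fin 10)) (X : List (Fin 10 × Fin 10)) (col : Fin 10 → Fin 3)
    (p q : Fin 10) : Prop :=
  p ∈ emp ∨ q ∈ emp ∨ col p ≠ col q ∨ (p, q) ∈ X ∨ (q, p) ∈ X

instance (emp X col p q) : Decidable (ChkE emp X col p q) := inferInstanceAs (Decidable (_ ∨ _))

def Chk (emp : List (Fin 10)) (X : List (Fin 10 × Fin 10)) (col cc : Fin 10 → Fin 3) : Prop :=
  (∀ p, ev p → ChkC emp col cc p) ∧ (∀ p q, pot p q → ChkE emp X col p q)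

instance (emp X col cc) : Decidable (Chk emp X col cc) := inferInstanceAs (Decidable (_ ∧ _))

theorem mkGood (h : Abs ne E S) (emp : List (Fin 10)) (X : List (Fin 10 × Fin 10))
    (col cc : Fin 10 → Fin 3) (hc : Chk emp X col cc) (he : ∀ p ∈ emp, ¬ ne p)
    (hX : ∀ z ∈ X, ¬ E z.1 z.2) (hw : ∀ w, ∃ k, ∀ p, S w p → col p ≠ k) : Good ne E S := by
  refine ⟨col, cc, fun p e => (hc.1 p e).1, ?_, ?_, hw⟩
  · intro p e
    obtain ⟨a, b, c⟩ := (hc.1 p e).2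
    exact ⟨fun n => a.resolve_left fun m => he _ m n, fun n => b.resolve_left fun m => he _ m n,
      fun n => c.resolve_left fun m => he _ m n⟩
  · intro p q e
    rcases hc.2 p q (h.Epot _ _ e) with a | a | a | a | a
    · exact absurd (h.Ene _ _ e) (he _ a)
    · exact absurd (h.Ene _ _ (h.Esymm _ _ e)) (he _ a)
    · exact a
    · exact absurd e (hX _ a)
    · exact absurd (h.Esymm _ _ e) (hX _ a)

/-- two nodes which are seen by `w` or empty are anticomplete -/
theorem Abs.notE (h : Abs ne E S) (w : W) (p q : Fin 10) (hp : ne p → S w p)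
    (hq : ne q → S w q) : ¬ E p q := fun e =>
  h.SE w p q e (hp (h.Ene _ _ e)) (hq (h.Ene _ _ (h.Esymm _ _ e)))

end
end ForkAux

namespace ForkAux
section
variable {W : Type} {ne : Fin 10 → Prop} {E : Fin 10 → Fin 10 → Prop} {S : W → Fin 10 → Prop}

theorem two_col (emp : List (Fin 10)) (col : Fin 10 → Fin 3) (h : Abs ne E S)
    (he : ∀ p ∈ emp, ¬ ne p) (k : Fin 3) (hk : ∀ p, p ∈ emp ∨ col p ≠ k) :
    ∀ w, ∃ k, ∀ p, S w p → col p ≠ k := fun w =>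
  ⟨k, fun p hp => (hk p).resolve_left fun m => he p m (h.Sne w p hp)⟩

/-- `w0` sees an opposite pair 0, 5 and one of 2, 3 -/
theorem leafOpp (h : Abs ne E S) (w : W) (s0 : S w 0) (s5 : S w 5) (s23 : S w 2 ∨ S w 3) :
    Good ne E S := by
  obtain ⟨n4, n6⟩ : ¬ ne 4 ∧ ¬ ne 6 := h.opp w 0 (by decide) s0 s5
  have n1 : ¬ ne 1 := fun n => n6 (h.gd w 1 (by decide) (h.Sadj1 w 0 s0 n))
  have n9 : ¬ ne 9 := fun n => n4 (h.gd w 9 (by decide) (h.Sadj2 w 0 s0 n))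
  have a2 : ne 2 → S w 2 := fun n => s23.elim id fun s => h.Sadj2 w 3 s n
  have a3 : ne 3 → S w 3 := fun n => s23.elim (fun s => h.Sadj1 w 2 s n) id
  have he : ∀ p ∈ ([4, 6, 1, 9] : List (Fin 10)), ¬ ne p := by simp [*]
  refine mkGood h [4, 6, 1, 9] [(0, 2), (0, 3), (0, 5), (2, 5)] ![2,2,2,2,2,2,0,0,0,0]
    ![0,0,0,0,1,0,1,0,2,0] (by decide) he ?_ (two_col [4, 6, 1, 9] _ h he 1 (by decide))
  simp only [List.forall_mem_cons, List.not_mem_nil, false_imp_iff, implies_true, and_true]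
  exact ⟨h.notE w _ _ (fun _ => s0) a2, h.notE w _ _ (fun _ => s0) a3,
    h.notE w _ _ (fun _ => s0) (fun _ => s5), h.notE w _ _ a2 (fun _ => s5)⟩

/-- `w` sees all nonempty nodes among 0..4 and 5, 9 are empty -/
theorem leafM (h : Abs ne E S) (w : W) (a0 : ne 0 → S w 0) (a1 : ne 1 → S w 1)
    (a2 : ne 2 → S w 2) (a3 : ne 3 → S w 3) (a4 : ne 4 → S w 4) (n5 : ¬ ne 5) (n9 : ¬ ne 9) :
    Good ne E S := by
  have hX : ∀ z ∈ ([(0, 2), (0, 3), (0, 4), (1, 4), (2, 4)] : List (Fin 10 × Fin 10)),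
      ¬ E z.1 z.2 := by
    simp only [List.forall_mem_cons, List.not_mem_nil, false_imp_iff, implies_true, and_true]
    exact ⟨h.notE w _ _ a0 a2, h.notE w _ _ a0 a3, h.notE w _ _ a0 a4, h.notE w _ _ a1 a4,
      h.notE w _ _ a2 a4⟩
  by_cases l : E 6 8
  · have n7 : ¬ ne 7 := h.link1 6 (by decide) l
    refine mkGood h [5, 9, 7] _ ![2,2,2,2,2,0,0,0,1,0]
      ![0,0,0,0,1,0,2,0,2,0] (by decide) (by simp [*]) hX ?_
    intro v
    by_cases s : S v 6
    · refine ⟨1, fun p hp => ?_⟩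
      have : ¬ S v 8 := h.SE v _ _ l s
      have : p ≠ 8 := by rintro rfl; exact this hp
      clear * - this; revert p; decide
    · refine ⟨0, fun p hp => ?_⟩
      have h6 : p ≠ 6 := by rintro rfl; exact s hp
      have h7 : p ≠ 7 := by rintro rfl; exact n7 (h.Sne _ _ hp)
      have h5 : p ≠ 5 := by rintro rfl; exact n5 (h.Sne _ _ hp)
      have h9 : p ≠ 9 := by rintro rfl; exact n9 (h.Sne _ _ hp)
      clear * - h5 h6 h7 h9; revert p; decide
  · have he : ∀ p ∈ ([5, 9] : List (Fin 10)), ¬ ne p := by simp [*]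
    refine mkGood h [5, 9] ((6, 8) :: [(0, 2), (0, 3), (0, 4), (1, 4), (2, 4)])
      ![2,2,2,2,2,0,0,0,0,0] ![0,0,0,0,1,0,2,0,2,0] (by decide) he ?_
      (two_col _ _ h he 1 (by decide))
    rw [List.forall_mem_cons]
    exact ⟨l, hX⟩

theorem leafM2 (h : Abs ne E S) (w : W) (s0 : S w 0) (s4 : S w 4)
    (n1 : ¬ ne 1) (n3 : ¬ ne 3) (n5 : ¬ ne 5) (n9 : ¬ ne 9)
    (a6 : ne 6 → S w 6) (a7 : ne 7 → S w 7) (s8 : ¬ S w 8) : Good ne E S := by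
  have hX : ∀ z ∈ ([(0, 4), (0, 6), (0, 7), (4, 7), (4, 6)] : List (Fin 10 × Fin 10)),
      ¬ E z.1 z.2 := by
    simp only [List.forall_mem_cons, List.not_mem_nil, false_imp_iff, implies_true, and_true]
    exact ⟨h.notE w _ _ (fun _ => s0) (fun _ => s4), h.notE w _ _ (fun _ => s0) a6,
      h.notE w _ _ (fun _ => s0) a7, h.notE w _ _ (fun _ => s4) a7,
      h.notE w _ _ (fun _ => s4) a6⟩
  by_cases n8 : ne 8
  · have n7 : ¬ ne 7 := fun n => s8 (h.Sadj1 w 7 (a7 n) n8)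
    by_cases l : E 2 8
    · refine mkGood h [1, 3, 5, 7, 9] _ ![2,0,0,0,2,0,2,0,1,0]
        ![1,0,1,0,0,0,0,0,2,0] (by decide) (by simp [*]) hX ?_
      intro v
      by_cases s : S v 2
      · refine ⟨1, fun p hp => ?_⟩
        have : ¬ S v 8 := h.SE v _ _ l s
        have : p ≠ 8 := by rintro rfl; exact this hp
        clear * - this; revert p; decide
      · refine ⟨0, fun p hp => ?_⟩
        have h2 : p ≠ 2 := by rintro rfl; exact s hp
        have h7 : p ≠ 7 := by rintro rfl; exact n7 (h.Sne _ _ hp)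
        have h5 : p ≠ 5 := by rintro rfl; exact n5 (h.Sne _ _ hp)
        have h9 : p ≠ 9 := by rintro rfl; exact n9 (h.Sne _ _ hp)
        have h1 : p ≠ 1 := by rintro rfl; exact n1 (h.Sne _ _ hp)
        have h3 : p ≠ 3 := by rintro rfl; exact n3 (h.Sne _ _ hp)
        clear * - h1 h2 h3 h5 h7 h9; revert p; decide
    · have he : ∀ p ∈ ([1, 3, 5, 7, 9] : List (Fin 10)), ¬ ne p := by simp [*]
      refine mkGood h _ ((2, 8) :: [(0, 4), (0, 6), (0, 7), (4, 7), (4, 6)])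
        ![2,0,0,0,2,0,2,0,0,0] ![1,0,1,0,0,0,0,0,2,0] (by decide) he ?_
        (two_col _ _ h he 1 (by decide))
      rw [List.forall_mem_cons]
      exact ⟨l, hX⟩
  · have he : ∀ p ∈ ([1, 3, 5, 8, 9] : List (Fin 10)), ¬ ne p := by simp [*]
    exact mkGood h _ _ ![2,0,0,0,2,0,2,2,0,0] ![0,0,2,0,1,0,1,0,0,0] (by decide) he hX
        (two_col _ _ h he 1 (by decide))

theorem leafN (h : Abs ne E S) (w : W) (s0 : S w 0) (s1 : S w 1) (s2 : S w 2)
    (n3 : ¬ ne 3) (n9 : ¬ ne 9) (hT : ∀ p, S w p → p = 0 ∨ p = 1 ∨ p = 2) : Good ne E S := by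
  have e02 : ¬ E 0 2 := h.notE w _ _ (fun _ => s0) (fun _ => s2)
  have key : ∀ v, v ≠ w → ∀ p, S v p → p ≠ 0 ∧ p ≠ 1 ∧ p ≠ 2 := by
    intro v hv p hp
    by_contra hcon
    have v1 : S v 1 := by
      by_contra hv1
      refine hcon ⟨?_, ?_, ?_⟩
      · rintro rfl; exact hv1 (h.Sadj1 v 0 hp (h.Sne _ _ s1))
      · rintro rfl; exact hv1 hp
      · rintro rfl; exact hv1 (h.Sadj2 v 2 hp (h.Sne _ _ s1))
    have v0 : S v 0 := h.Sadj2 v 1 v1 (h.Sne _ _ s0)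
    have v2 : S v 2 := h.Sadj1 v 1 v1 (h.Sne _ _ s2)
    obtain ⟨q, hq, hq'⟩ := h.inc w v hv.symm
    rcases hT q hq with rfl | rfl | rfl <;> contradiction
  have hw : ∀ col : Fin 10 → Fin 3, (∀ p, p ≠ 0 → p ≠ 1 → p ≠ 2 → p ≠ 3 → p ≠ 9 → col p ≠ 2) →
      (∀ p, p = 0 ∨ p = 1 ∨ p = 2 → col p ≠ 0) → ∀ v, ∃ k, ∀ p, S v p → col p ≠ k := by
    intro col c1 c2 v
    by_cases hv : v = w
    · subst hv
      exact ⟨0, fun p hp => c2 p (hT p hp)⟩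
    · refine ⟨2, fun p hp => ?_⟩
      obtain ⟨p0, p1, p2⟩ := key v hv p hp
      refine c1 p p0 p1 p2 ?_ ?_
      · rintro rfl; exact n3 (h.Sne _ _ hp)
      · rintro rfl; exact n9 (h.Sne _ _ hp)
  by_cases l1 : E 6 8
  · by_cases l2 : E 4 6
    · have n5 : ¬ ne 5 := h.link1 4 (by decide) l2
      have n7 : ¬ ne 7 := h.link1 6 (by decide) l1
      have e48 : ¬ E 4 8 := h.linkT 4 (by decide) l2 l1
      exact mkGood h [3, 9, 5, 7] [(0, 2), (4, 8)] ![2,2,2,0,1,0,0,0,1,0]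
        ![1,0,1,0,2,0,2,0,0,0] (by decide) (by simp [*]) (by simp [*])
        (hw _ (by decide) (by decide))
    · exact mkGood h [3, 9] [(0, 2), (4, 6)] ![2,2,2,0,0,0,0,1,1,0]
        ![0,0,1,0,1,0,2,0,0,0] (by decide) (by simp [*]) (by simp [*])
        (hw _ (by decide) (by decide))
  · exact mkGood h [3, 9] [(0, 2), (6, 8)] ![2,2,2,0,0,0,1,1,1,0]
        ![0,0,1,0,1,0,2,0,0,0] (by decide) (by simp [*]) (by simp [*])
        (hw _ (by decide) (by decide))

theorem leafP (h : Abs ne E S) (w : W) (a0 : ne 0 → S w 0) (a2 : ne 2 → S w 2)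
    (a3 : ne 3 → S w 3) (n4 : ¬ ne 4) (n9 : ¬ ne 9) : Good ne E S := by
  have e02 : ¬ E 0 2 := h.notE w _ _ a0 a2
  have e03 : ¬ E 0 3 := h.notE w _ _ a0 a3
  -- colouring with 5,6,7 ↦ 0 and 8 ↦ 1
  have c1 : (∀ v, S v 8 → ¬ S v 5 ∧ ¬ S v 6 ∧ ¬ S v 7) → Good ne E S := by
    intro hv
    refine mkGood h [4, 9] [(0, 2), (0, 3)] ![2,2,2,2,0,0,0,0,1,0] ![0,0,0,0,1,0,2,0,2,0]
      (by decide) (by simp [*]) (by simp [*]) ?_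
    intro v
    by_cases s : S v 8
    · obtain ⟨x5, x6, x7⟩ := hv v s
      refine ⟨0, fun p hp => ?_⟩
      have h4 : p ≠ 4 := by rintro rfl; exact n4 (h.Sne _ _ hp)
      have h5 : p ≠ 5 := by rintro rfl; exact x5 hp
      have h6 : p ≠ 6 := by rintro rfl; exact x6 hp
      have h7 : p ≠ 7 := by rintro rfl; exact x7 hp
      have h9 : p ≠ 9 := by rintro rfl; exact n9 (h.Sne _ _ hp)
      clear * - h4 h5 h6 h7 h9; revert p; decide
    · refine ⟨1, fun p hp => ?_⟩
      have h8 : p ≠ 8 := by rintro rfl; exact s hp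
      clear * - h8; revert p; decide
  by_cases l : E 6 8
  · have n7 : ¬ ne 7 := h.link1 6 (by decide) l
    refine c1 fun v s => ?_
    have x6 : ¬ S v 6 := fun t => h.SE v _ _ l t s
    exact ⟨fun t => x6 (h.Sadj1 v 5 t (h.Ene _ _ l)), x6, fun t => n7 (h.Sne _ _ t)⟩
  by_cases l5 : E 5 8
  · by_cases n6 : ne 6
    · refine c1 fun v s => ?_
      have x5 : ¬ S v 5 := fun t => h.SE v _ _ l5 t s
      have x6 : ¬ S v 6 := fun t => x5 (h.Sadj2 v 6 t (h.Ene _ _ l5))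
      exact ⟨x5, x6, fun t => x6 (h.Sadj2 v 7 t n6)⟩
    · refine mkGood h [4, 9, 6] [(0, 2), (0, 3)] ![2,2,2,2,0,1,0,0,0,0] ![1,0,0,0,0,0,2,0,2,0]
        (by decide) (by simp [*]) (by simp [*]) ?_
      intro v
      by_cases s : S v 5
      · have x8 : ¬ S v 8 := h.SE v _ _ l5 s
        have x7 : ¬ S v 7 := fun t => x8 (h.Sadj1 v 7 t (h.Ene _ _ (h.Esymm _ _ l5)))
        refine ⟨0, fun p hp => ?_⟩
        have h4 : p ≠ 4 := by rintro rfl; exact n4 (h.Sne _ _ hp)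
        have h8 : p ≠ 8 := by rintro rfl; exact x8 hp
        have h6 : p ≠ 6 := by rintro rfl; exact n6 (h.Sne _ _ hp)
        have h7 : p ≠ 7 := by rintro rfl; exact x7 hp
        have h9 : p ≠ 9 := by rintro rfl; exact n9 (h.Sne _ _ hp)
        clear * - h4 h8 h6 h7 h9; revert p; decide
      · refine ⟨1, fun p hp => ?_⟩
        have h5 : p ≠ 5 := by rintro rfl; exact s hp
        clear * - h5; revert p; decide
  · have he : ∀ p ∈ ([4, 9] : List (Fin 10)), ¬ ne p := by simp [*]
    exact mkGood h [4, 9] [(0, 2), (0, 3), (6, 8), (5, 8)] ![2,2,2,2,0,0,0,0,0,0]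
      ![0,0,0,0,1,0,2,0,2,0] (by decide) he (by simp [*])
      (two_col _ _ h he 1 (by decide))

theorem caseOpp (h : Abs ne E S) (w : W) (s0 : S w 0) (s5 : S w 5) (q : Fin 10) (hq : S w q)
    (q0 : q ≠ 0) (q5 : q ≠ 5) : Good ne E S := by
  obtain ⟨n4, n6⟩ : ¬ ne 4 ∧ ¬ ne 6 := h.opp w 0 (by decide) s0 s5
  have n1 : ¬ ne 1 := fun n => n6 (h.gd w 1 (by decide) (h.Sadj1 w 0 s0 n))
  have n9 : ¬ ne 9 := fun n => n4 (h.gd w 9 (by decide) (h.Sadj2 w 0 s0 n))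
  have n := h.Sne w q hq
  by_cases hh : S w 2 ∨ S w 3
  · exact leafOpp h w s0 s5 hh
  · refine Good.of_neg (leafOpp h.neg w s0 s5 ?_)
    have : q = 8 ∨ q = 7 := by
      have h1 : q ≠ 1 := by rintro rfl; exact n1 n
      have h2 : q ≠ 2 := by rintro rfl; exact hh (Or.inl hq)
      have h3 : q ≠ 3 := by rintro rfl; exact hh (Or.inr hq)
      have h4 : q ≠ 4 := by rintro rfl; exact n4 n
      have h6 : q ≠ 6 := by rintro rfl; exact n6 n
      have h9 : q ≠ 9 := by rintro rfl; exact n9 n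
      clear * - q0 q5 h1 h2 h3 h4 h6 h9; revert q; decide
    rcases this with rfl | rfl
    · exact Or.inl hq
    · exact Or.inr hq

theorem case04 (h : Abs ne E S) (w : W) (s0 : S w 0) (s4 : S w 4) (q : Fin 10) (hq : S w q)
    (q0 : q ≠ 0) (q4 : q ≠ 4) : Good ne E S := by
  obtain ⟨n9, n5⟩ : ¬ ne 9 ∧ ¬ ne 5 := h.e4 w 0 (by decide) s0 s4
  have a1 : ne 1 → S w 1 := h.Sadj1 w 0 s0
  have a3 : ne 3 → S w 3 := h.Sadj2 w 4 s4
  by_cases a2 : ne 2 → S w 2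
  · exact leafM h w (fun _ => s0) a1 a2 a3 (fun _ => s4) n5 n9
  push Not at a2
  obtain ⟨n2, t2⟩ := a2
  have n1 : ¬ ne 1 := fun n => t2 (h.Sadj1 w 1 (a1 n) n2)
  have n3 : ¬ ne 3 := fun n => t2 (h.Sadj2 w 3 (a3 n) n2)
  have n := h.Sne w q hq
  have hq' : q = 6 ∨ q = 7 ∨ q = 8 := by
    have h1 : q ≠ 1 := by rintro rfl; exact n1 n
    have h2 : q ≠ 2 := by rintro rfl; exact t2 hq
    have h3 : q ≠ 3 := by rintro rfl; exact n3 n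
    have h5 : q ≠ 5 := by rintro rfl; exact n5 n
    have h9 : q ≠ 9 := by rintro rfl; exact n9 n
    clear * - q0 q4 h1 h2 h3 h5 h9; grind
  by_cases s6 : S w 6
  · by_cases s8 : S w 8
    · exact Good.of_shift 4 (by decide) (leafM (h.shift 4 (by decide)) w (fun _ => s4)
        (fun n => absurd n n5) (fun _ => s6) (fun n => h.Sadj1 w 6 s6 n) (fun _ => s8) n9 n3)
    · exact leafM2 h w s0 s4 n1 n3 n5 n9 (fun _ => s6) (h.Sadj1 w 6 s6) s8
  · by_cases s8 : S w 8
    · refine Good.of_neg (Good.of_shift 6 (by decide) (leafM2 (h.neg.shift 6 (by decide)) w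
        s4 s0 n3 n1 n9 n5 (fun _ => s8) (fun n => h.Sadj2 w 8 s8 n) s6))
    · have s7 : S w 7 := by
        rcases hq' with rfl | rfl | rfl
        · contradiction
        · exact hq
        · contradiction
      exact leafM2 h w s0 s4 n1 n3 n5 n9 (fun n => h.Sadj2 w 7 s7 n) (fun _ => s7) s8

theorem case02a (h : Abs ne E S) (w : W) (s0 : S w 0) (s2 : S w 2) (s3 : S w 3)
    (t4 : ¬ S w 4) (t8 : ¬ S w 8) : Good ne E S := by
  have n4 : ¬ ne 4 := fun n => t4 (h.Sadj1 w 3 s3 n)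
  have n8 : ne 8 := h.gd w 3 (by decide) s3
  have n9 : ¬ ne 9 := fun n => t8 (h.Sadj2 w 9 (h.Sadj2 w 0 s0 n) n8)
  exact leafP h w (fun _ => s0) (fun _ => s2) (fun _ => s3) n4 n9

theorem case02 (h : Abs ne E S) (w : W) (s0 : S w 0) (s2 : S w 2)
    (hopp : ∀ p, ev p → S w p → ¬ S w (p + 5)) (h4 : ∀ p, ev p → S w p → ¬ S w (p + 4))
    (q : Fin 10) (hq : S w q) (q0 : q ≠ 0) (q2 : q ≠ 2) : Good ne E S := by
  have t4 : ¬ S w 4 := h4 0 (by decide) s0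
  have t6 : ¬ S w 6 := h4 2 (by decide) s2
  have t8 : ¬ S w 8 := fun s => h4 8 (by decide) s s2
  have t5 : ¬ S w 5 := hopp 0 (by decide) s0
  have t7 : ¬ S w 7 := hopp 2 (by decide) s2
  by_cases s3 : S w 3
  · exact case02a h w s0 s2 s3 t4 t8
  by_cases s9 : S w 9
  · exact Good.of_neg (Good.of_shift 8 (by decide) (case02a (h.neg.shift 8 (by decide)) w
      s2 s0 s9 t8 t4))
  have n3 : ¬ ne 3 := fun n => s3 (h.Sadj1 w 2 s2 n)
  have n9 : ¬ ne 9 := fun n => s9 (h.Sadj2 w 0 s0 n)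
  have hT : ∀ p, S w p → p = 0 ∨ p = 1 ∨ p = 2 := by
    intro p hp
    have h3 : p ≠ 3 := by rintro rfl; exact s3 hp
    have h4 : p ≠ 4 := by rintro rfl; exact t4 hp
    have h5 : p ≠ 5 := by rintro rfl; exact t5 hp
    have h6 : p ≠ 6 := by rintro rfl; exact t6 hp
    have h7 : p ≠ 7 := by rintro rfl; exact t7 hp
    have h8 : p ≠ 8 := by rintro rfl; exact t8 hp
    have h9 : p ≠ 9 := by rintro rfl; exact s9 hp
    clear * - h3 h4 h5 h6 h7 h8 h9; grind
  have s1 : S w 1 := by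
    rcases hT q hq with rfl | rfl | rfl
    · contradiction
    · exact hq
    · contradiction
  exact leafN h w s0 s1 s2 n3 n9 hT

theorem case0a (h : Abs ne E S) (w : W) (s0 : S w 0) (s3 : S w 3) (t2 : ¬ S w 2) (t4 : ¬ S w 4)
    (t8 : ¬ S w 8) : Good ne E S := by
  have n4 : ¬ ne 4 := fun n => t4 (h.Sadj1 w 3 s3 n)
  have n2 : ¬ ne 2 := fun n => t2 (h.Sadj2 w 3 s3 n)
  have n8 : ne 8 := h.gd w 3 (by decide) s3
  have n9 : ¬ ne 9 := fun n => t8 (h.Sadj2 w 9 (h.Sadj2 w 0 s0 n) n8)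
  exact leafP h w (fun _ => s0) (fun n => absurd n n2) (fun _ => s3) n4 n9

theorem case0 (h : Abs ne E S) (w : W) (s0 : S w 0)
    (hopp : ∀ p, ev p → S w p → ¬ S w (p + 5)) (h4 : ∀ p, ev p → S w p → ¬ S w (p + 4))
    (h2 : ∀ p, ev p → S w p → ¬ S w (p + 2)) : Good ne E S := by
  have t4 : ¬ S w 4 := h4 0 (by decide) s0
  have t6 : ¬ S w 6 := fun s => h4 6 (by decide) s s0
  have t8 : ¬ S w 8 := fun s => h2 8 (by decide) s s0
  have t2 : ¬ S w 2 := h2 0 (by decide) s0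
  have t5 : ¬ S w 5 := hopp 0 (by decide) s0
  obtain ⟨q, hq, q9, q0, q1⟩ := h.dom w 0 (by decide)
  have : q = 3 ∨ q = 7 := by
    have h2 : q ≠ 2 := by rintro rfl; exact t2 hq
    have h4 : q ≠ 4 := by rintro rfl; exact t4 hq
    have h5 : q ≠ 5 := by rintro rfl; exact t5 hq
    have h6 : q ≠ 6 := by rintro rfl; exact t6 hq
    have h8 : q ≠ 8 := by rintro rfl; exact t8 hq
    clear * - h2 h4 h5 h6 h8 q9 q0 q1; revert q; decide
  rcases this with rfl | rfl
  · exact case0a h w s0 hq t2 t4 t8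
  · exact Good.of_neg (case0a h.neg w s0 hq t8 t6 t2)

theorem big (h : Abs ne E S) (w : W) (a b c : Fin 10) (sa : S w a) (sb : S w b) (sc : S w c)
    (hab : a ≠ b) (hac : a ≠ c) (hbc : b ≠ c) : Good ne E S := by
  have third : ∀ x y : Fin 10, ∃ q, S w q ∧ q ≠ x ∧ q ≠ y := by
    intro x y
    have : (a ≠ x ∧ a ≠ y) ∨ (b ≠ x ∧ b ≠ y) ∨ (c ≠ x ∧ c ≠ y) := by grind
    rcases this with t | t | t
    · exact ⟨a, sa, t⟩
    · exact ⟨b, sb, t⟩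
    · exact ⟨c, sc, t⟩
  have sh : ∀ {k q : Fin 10}, S w q → S w (q - k + k) := by
    intro k q hq; rwa [sub_add_cancel]
  have shn : ∀ {k q m : Fin 10}, q ≠ m + k → q - k ≠ m := by
    intro k q m hq e; exact hq (by rw [← e, sub_add_cancel])
  by_cases hopp : ∃ p, ev p ∧ S w p ∧ S w (p + 5)
  · obtain ⟨p, e, s1, s2⟩ := hopp
    obtain ⟨q, hq, q1, q2⟩ := third p (p + 5)
    refine Good.of_shift p e (caseOpp (h.shift p e) w (by simpa using s1)
      (by simpa [add_comm] using s2) (q - p) (sh hq) (shn ?_) (shn ?_))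
    · simpa using q1
    · simpa [add_comm] using q2
  by_cases h4 : ∃ p, ev p ∧ S w p ∧ S w (p + 4)
  · obtain ⟨p, e, s1, s2⟩ := h4
    obtain ⟨q, hq, q1, q2⟩ := third p (p + 4)
    refine Good.of_shift p e (case04 (h.shift p e) w (by simpa using s1)
      (by simpa [add_comm] using s2) (q - p) (sh hq) (shn ?_) (shn ?_))
    · simpa using q1
    · simpa [add_comm] using q2
  push Not at hopp h4
  have evs : ∀ p k : Fin 10, ev k → ev p → ev (p + k) := by decide
  by_cases h2 : ∃ p, ev p ∧ S w p ∧ S w (p + 2)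
  · obtain ⟨p, e, s1, s2⟩ := h2
    obtain ⟨q, hq, q1, q2⟩ := third p (p + 2)
    refine Good.of_shift p e (case02 (h.shift p e) w (by simpa using s1)
      (by simpa [add_comm] using s2) ?_ ?_ (q - p) (sh hq) (shn ?_) (shn ?_))
    · intro x ex sx
      have := hopp _ (evs x p e ex) sx
      rwa [add_right_comm] at this
    · intro x ex sx
      have := h4 _ (evs x p e ex) sx
      rwa [add_right_comm] at this
    · simpa using q1
    · simpa [add_comm] using q2
  push Not at h2
  by_cases h0 : ∃ p, ev p ∧ S w p
  · obtain ⟨p, e, s1⟩ := h0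
    refine Good.of_shift p e (case0 (h.shift p e) w (by simpa using s1) ?_ ?_ ?_)
    · intro x ex sx
      have := hopp _ (evs x p e ex) sx
      rwa [add_right_comm] at this
    · intro x ex sx
      have := h4 _ (evs x p e ex) sx
      rwa [add_right_comm] at this
    · intro x ex sx
      have := h2 _ (evs x p e ex) sx
      rwa [add_right_comm] at this
  push Not at h0
  exfalso
  have odd4 : ∀ p, S w p → ¬ S w (p + 4) := by
    intro p s1 s2
    have o1 : ¬ ev p := fun e => h0 p e s1
    have o2 : ¬ ev (p + 4) := fun e => h0 _ e s2
    have n := h.gd w _ o2 s2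
    rw [show p + 4 + 5 = p - 1 by clear * -; revert p; decide] at n
    exact h0 _ (by clear * - o1; revert p; decide) (h.Sadj2 w p s1 n)
  have oa : ¬ ev a := fun e => h0 a e sa
  have ob : ¬ ev b := fun e => h0 b e sb
  have oc : ¬ ev c := fun e => h0 c e sc
  have : b = a + 4 ∨ a = b + 4 ∨ c = a + 4 ∨ a = c + 4 ∨ b = c + 4 ∨ c = b + 4 := by
    clear * - oa ob oc hab hac hbc
    revert hab hac hbc oa ob oc
    revert a b c; decide
  rcases this with e | e | e | e | e | e
  · exact odd4 a sa (e ▸ sb)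
  · exact odd4 b sb (e ▸ sa)
  · exact odd4 a sa (e ▸ sc)
  · exact odd4 c sc (e ▸ sa)
  · exact odd4 c sc (e ▸ sb)
  · exact odd4 b sb (e ▸ sc)
end
end ForkAux

namespace ForkAux
section
variable {W : Type} {ne : Fin 10 → Prop} {E : Fin 10 → Fin 10 → Prop} {S : W → Fin 10 → Prop}

/-- every vertex of `W` sees at most two nodes -/
def Small (S : W → Fin 10 → Prop) : Prop :=
  ∀ w a b c, S w a → S w b → S w c → a ≠ b → a ≠ c → b ≠ c → False

theorem Small.hw (h : Small S) (col : Fin 10 → Fin 3) : ∀ w, ∃ k, ∀ p, S w p → col p ≠ k := by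
  intro w
  by_contra hcon
  push Not at hcon
  obtain ⟨a, sa, ha⟩ := hcon 0
  obtain ⟨b, sb, hb⟩ := hcon 1
  obtain ⟨c, sc, hc⟩ := hcon 2
  refine h w a b c sa sb sc ?_ ?_ ?_ <;> rintro rfl <;> simp_all

theorem Small.shift (h : Small S) (k : Fin 10) : Small (fun w p => S w (p + k)) := by
  intro w a b c sa sb sc hab hac hbc
  exact h w _ _ _ sa sb sc (by simpa using hab) (by simpa using hac) (by simpa using hbc)

theorem Small.neg (h : Small S) : Small (fun w p => S w (-p)) := by
  intro w a b c sa sb sc hab hac hbc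
  exact h w _ _ _ sa sb sc (by simpa using hab) (by simpa using hac) (by simpa using hbc)

theorem empty4b (h : Abs ne E S) (hs : Small S) (n4 : ¬ ne 4) (l : E 8 0) (l2 : E 0 2) :
    Good ne E S := by
  have n9 : ¬ ne 9 := h.link1 8 (by decide) l
  have n1 : ¬ ne 1 := h.link1 0 (by decide) l2
  have e82 : ¬ E 8 2 := h.linkT 8 (by decide) l l2
  have e03 : ¬ E 0 3 := (h.h1 0 (by decide) l2 (h.Esymm _ _ l)).1
  exact mkGood h [4, 9, 1] [(8, 2), (0, 3)] ![0,0,1,0,0,2,2,2,1,0] ![2,0,2,0,1,0,1,0,0,0]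
    (by decide) (by simp [*]) (by simp [*]) (hs.hw _)

theorem empty4 (h : Abs ne E S) (hs : Small S) (n4 : ¬ ne 4) : Good ne E S := by
  by_cases l : E 8 0
  · have n9 : ¬ ne 9 := h.link1 8 (by decide) l
    by_cases l2 : E 0 2
    · exact empty4b h hs n4 l l2
    by_cases l3 : E 6 8
    · exact Good.of_neg (Good.of_shift 2 (by decide)
        (empty4b (h.neg.shift 2 (by decide)) (hs.neg.shift 2) n4 (h.Esymm _ _ l)
          (h.Esymm _ _ l3)))
    · exact mkGood h [4, 9] [(0, 2), (6, 8)] ![1,1,1,0,0,0,2,2,2,0] ![0,0,2,0,1,0,1,0,0,0]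
        (by decide) (by simp [*]) (by simp [*]) (hs.hw _)
  · exact mkGood h [4] [(8, 0)] ![2,1,1,1,0,0,0,0,2,2] ![0,0,2,0,2,0,1,0,1,0]
      (by decide) (by simp [*]) (by simp [*]) (hs.hw _)

theorem links3 (h : Abs ne E S) (hs : Small S) (l1 : E 4 6) (l2 : E 6 8) (l3 : E 8 0) :
    Good ne E S := by
  have n5 : ¬ ne 5 := h.link1 4 (by decide) l1
  have n7 : ¬ ne 7 := h.link1 6 (by decide) l2
  have n9 : ¬ ne 9 := h.link1 8 (by decide) l3
  have e48 : ¬ E 4 8 := h.linkT 4 (by decide) l1 l2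
  have e60 : ¬ E 6 0 := h.linkT 6 (by decide) l2 l3
  exact mkGood h [5, 7, 9] [(4, 8), (6, 0)] ![1,2,2,2,0,0,1,0,0,0] ![0,0,0,0,1,0,2,0,2,0]
    (by decide) (by simp [*]) (by simp [*]) (hs.hw _)

theorem linksQ (h : Abs ne E S) (hs : Small S) (n1 : ¬ ne 1) (l1 : ¬ E 2 4) (l3 : ¬ E 8 0) :
    Good ne E S :=
  mkGood h [1] [(2, 4), (8, 0)] ![2,0,1,1,1,0,0,0,2,2] ![0,0,0,0,2,0,1,0,1,0]
    (by decide) (by simp [*]) (by simp [*]) (hs.hw _)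

theorem linksPair (h : Abs ne E S) (hs : Small S) (l0 : E 0 2) (l2 : E 2 4) (l4 : ¬ E 4 6)
    (l8 : ¬ E 8 0) (n6 : ne 6) (n8 : ne 8) : Good ne E S := by
  have n1 : ¬ ne 1 := h.link1 0 (by decide) l0
  have n3 : ¬ ne 3 := h.link1 2 (by decide) l2
  have hh : ¬ (E 7 4 ∧ E 7 0) := h.h2 2 (by decide) l2 (h.Esymm _ _ l0) n6 n8
  by_cases e : E 7 0
  · have e4 : ¬ E 7 4 := fun e' => hh ⟨e', e⟩
    exact mkGood h [1, 3] [(4, 6), (8, 0), (7, 4)] ![1,0,0,0,2,2,2,2,1,1] ![2,0,1,0,1,0,0,0,0,0]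
      (by decide) (by simp [*]) (by simp [*]) (hs.hw _)
  · exact mkGood h [1, 3] [(4, 6), (8, 0), (7, 0)] ![1,0,0,0,2,2,2,1,1,1] ![2,0,1,0,1,0,0,0,0,0]
      (by decide) (by simp [*]) (by simp [*]) (hs.hw _)

theorem abs_main (h : Abs ne E S) : Good ne E S ∨
    ((∀ p, ne p) ∧ (∀ p, ev p → ¬ E p (p + 2)) ∧ IsEmpty W) := by
  by_cases hs : Small S
  swap
  · left
    unfold Small at hs
    push Not at hs
    obtain ⟨w, a, b, c, sa, sb, sc, h1, h2, h3, -⟩ := hs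
    exact big h w a b c sa sb sc h1 h2 h3
  by_cases hev : ∀ p, ev p → ne p
  swap
  · left
    push Not at hev
    obtain ⟨p, e, n⟩ := hev
    have e' : ev (p - 4) := by clear * - e; revert p; decide
    refine Good.of_shift (p - 4) e' (empty4 (h.shift _ e') (hs.shift _) ?_)
    simpa using n
  have G3 : ∀ p, ev p → E (4 + p) (6 + p) → E (6 + p) (8 + p) → E (8 + p) (0 + p) →
      Good ne E S := fun p e l1 l2 l3 =>
    Good.of_shift p e (links3 (h.shift p e) (hs.shift p) l1 l2 l3)
  have GQ : ∀ p, ev p → ¬ ne (1 + p) → ¬ E (2 + p) (4 + p) → ¬ E (8 + p) (0 + p) →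
      Good ne E S := fun p e l1 l2 l3 =>
    Good.of_shift p e (linksQ (h.shift p e) (hs.shift p) l1 l2 l3)
  have GP : ∀ p, ev p → E (0 + p) (2 + p) → E (2 + p) (4 + p) → ¬ E (4 + p) (6 + p) →
      ¬ E (8 + p) (0 + p) → Good ne E S := fun p e l1 l2 l3 l4 =>
    Good.of_shift p e (linksPair (h.shift p e) (hs.shift p) l1 l2 l3 l4
      (hev _ (by clear * - e; revert p; decide)) (hev _ (by clear * - e; revert p; decide)))
  by_contra hcon
  rw [not_or] at hcon
  obtain ⟨hg, hcon⟩ := hcon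
  have a0 : E 0 2 → ¬ ne 1 := h.link1 0 (by decide)
  have a2 : E 2 4 → ¬ ne 3 := h.link1 2 (by decide)
  have a4 : E 4 6 → ¬ ne 5 := h.link1 4 (by decide)
  have a6 : E 6 8 → ¬ ne 7 := h.link1 6 (by decide)
  have a8 : E 8 0 → ¬ ne 9 := h.link1 8 (by decide)
  have t0 : E 4 6 → E 6 8 → ¬ E 8 0 := fun x y z => hg (G3 0 (by decide) x y z)
  have t2 : E 6 8 → E 8 0 → ¬ E 0 2 := fun x y z => hg (G3 2 (by decide) x y z)
  have t4 : E 8 0 → E 0 2 → ¬ E 2 4 := fun x y z => hg (G3 4 (by decide) x y z)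
  have t6 : E 0 2 → E 2 4 → ¬ E 4 6 := fun x y z => hg (G3 6 (by decide) x y z)
  have t8 : E 2 4 → E 4 6 → ¬ E 6 8 := fun x y z => hg (G3 8 (by decide) x y z)
  have q0 : ¬ ne 1 → ¬ E 2 4 → ¬¬ E 8 0 := fun x y z => hg (GQ 0 (by decide) x y z)
  have q2 : ¬ ne 3 → ¬ E 4 6 → ¬¬ E 0 2 := fun x y z => hg (GQ 2 (by decide) x y z)
  have q4 : ¬ ne 5 → ¬ E 6 8 → ¬¬ E 2 4 := fun x y z => hg (GQ 4 (by decide) x y z)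
  have q6 : ¬ ne 7 → ¬ E 8 0 → ¬¬ E 4 6 := fun x y z => hg (GQ 6 (by decide) x y z)
  have q8 : ¬ ne 9 → ¬ E 0 2 → ¬¬ E 6 8 := fun x y z => hg (GQ 8 (by decide) x y z)
  have p0 : E 0 2 → E 2 4 → ¬ E 4 6 → ¬¬ E 8 0 := fun x y z u => hg (GP 0 (by decide) x y z u)
  have p2 : E 2 4 → E 4 6 → ¬ E 6 8 → ¬¬ E 0 2 := fun x y z u => hg (GP 2 (by decide) x y z u)
  have p4 : E 4 6 → E 6 8 → ¬ E 8 0 → ¬¬ E 2 4 := fun x y z u => hg (GP 4 (by decide) x y z u)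
  have p6 : E 6 8 → E 8 0 → ¬ E 0 2 → ¬¬ E 4 6 := fun x y z u => hg (GP 6 (by decide) x y z u)
  have p8 : E 8 0 → E 0 2 → ¬ E 2 4 → ¬¬ E 6 8 := fun x y z u => hg (GP 8 (by decide) x y z u)
  have all : (¬ E 0 2 ∧ ¬ E 2 4 ∧ ¬ E 4 6 ∧ ¬ E 6 8 ∧ ¬ E 8 0) ∧ ne 1 ∧ ne 3 ∧ ne 5 ∧ ne 7 ∧ ne 9 := by
    clear * - a0 a2 a4 a6 a8 t0 t2 t4 t6 t8 q0 q2 q4 q6 q8 p0 p2 p4 p6 p8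
    by_cases x0 : E 0 2 <;> by_cases x2 : E 2 4 <;> by_cases x4 : E 4 6 <;>
      by_cases x6 : E 6 8 <;> by_cases x8 : E 8 0 <;> simp_all
  obtain ⟨⟨b0, b2, b4, b6, b8⟩, m1, m3, m5, m7, m9⟩ := all
  have hne : ∀ p, ne p := by
    intro p
    by_cases e : ev p
    · exact hev p e
    · have : p = 1 ∨ p = 3 ∨ p = 5 ∨ p = 7 ∨ p = 9 := by clear * - e; revert p; decide
      rcases this with rfl | rfl | rfl | rfl | rfl <;> assumption
  refine hcon ⟨hne, ?_, ⟨fun w => ?_⟩⟩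
  · intro p e
    have : p = 0 ∨ p = 2 ∨ p = 4 ∨ p = 6 ∨ p = 8 := by clear * - e; revert p; decide
    rcases this with rfl | rfl | rfl | rfl | rfl <;> assumption
  · obtain ⟨q, sq, -⟩ := h.dom w 0 (by decide)
    have s1 := h.Sadj1 w q sq (hne _)
    have s2 := h.Sadj1 w _ s1 (hne _)
    refine hs w _ _ _ sq s1 s2 ?_ ?_ ?_ <;> clear * - <;> revert q <;> decide
end
end ForkAux

namespace ForkAux

theorem no_fork {V : Type} {G : SimpleGraph V}
    (tf : ∀ a b c, G.Adj a b → G.Adj b c → G.Adj a c → False) (ff : ForkFree G)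
    (z l1 l2 x xx y yy : V) (hl : l1 ≠ l2) (a1 : G.Adj z l1) (a2 : G.Adj z l2) (a3 : G.Adj z x)
    (a4 : G.Adj z y) (a5 : G.Adj x xx) (a6 : G.Adj y yy) (b1 : ¬ G.Adj xx l1) (b2 : ¬ G.Adj xx l2)
    (b3 : ¬ G.Adj xx y) (b4 : ¬ G.Adj yy l1) (b5 : ¬ G.Adj yy l2) (b6 : ¬ G.Adj yy x)
    (b7 : ¬ G.Adj xx yy) : False := by
  have t : ∀ u v, G.Adj z u → G.Adj z v → ¬ G.Adj u v := fun u v h1 h2 h3 => tf z u v h1 h3 h2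
  have c1 := t _ _ a1 a2
  have c2 := t _ _ a1 a3
  have c3 := t _ _ a1 a4
  have c4 := t _ _ a2 a3
  have c5 := t _ _ a2 a4
  have c6 := t _ _ a3 a4
  have d1 : ¬ G.Adj z xx := fun h => tf z x xx a3 a5 h
  have d2 : ¬ G.Adj z yy := fun h => tf z y yy a4 a6 h
  have hadj : ∀ i j : Fin 7, G.Adj ((![z, l1, l2, x, xx, y, yy] : Fin 7 → V) i)
      ((![z, l1, l2, x, xx, y, yy] : Fin 7 → V) j) ↔ fork.Adj i j := by
    have s : ∀ {u v}, G.Adj u v → G.Adj v u := fun h => h.symm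
    have ns : ∀ {u v}, ¬ G.Adj u v → ¬ G.Adj v u := fun h h' => h h'.symm
    intro i j
    fin_cases i <;> fin_cases j <;>
      simp [fork, a1, a2, a3, a4, a5, a6, b1, b2, b3, b4, b5, b6, b7, c1, c2, c3, c4, c5, c6, d1, d2,
        s a1, s a2, s a3, s a4, s a5, s a6, ns b1, ns b2, ns b3, ns b4, ns b5, ns b6, ns b7,
        ns c1, ns c2, ns c3, ns c4, ns c5, ns c6, ns d1, ns d2]
  have hinj : Function.Injective (![z, l1, l2, x, xx, y, yy] : Fin 7 → V) := by
    intro i j hij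
    by_contra hne
    have key : ∀ k, fork.Adj i k ↔ fork.Adj j k := fun k => by rw [← hadj, ← hadj, hij]
    have hx : (i = 1 ∧ j = 2) ∨ (i = 2 ∧ j = 1) := by
      have k0 := key 0
      have k1 := key 1
      have k2 := key 2
      have k3 := key 3
      have k4 := key 4
      have k5 := key 5
      have k6 := key 6
      clear * - k0 k1 k2 k3 k4 k5 k6 hne
      revert i j
      unfold fork
      simp only [SimpleGraph.fromEdgeSet_adj]
      simp only [Set.mem_insert_iff, Set.mem_singleton_iff, Sym2.eq_iff]
      intro i j
      fin_cases i <;> fin_cases j <;> simp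
    rcases hx with ⟨rfl, rfl⟩ | ⟨rfl, rfl⟩
    · exact hl hij
    · exact hl hij.symm
  exact ff.false ⟨⟨_, hinj⟩, fun {i j} => hadj i j⟩

section minimal
variable {V : Type} [Fintype V] {G : SimpleGraph V}

theorem min_tf (hG : MinCex G) : ∀ a b c, G.Adj a b → G.Adj b c → G.Adj a c → False := by
  intro a b c h1 h2 h3
  classical
  exact hG.1 {a, b, c} (SimpleGraph.is3Clique_triple_iff.2 ⟨h1, h3, h2⟩)

theorem min_not_col (hG : MinCex G) : ¬ G.Colorable 3 := by
  intro h
  have := hG.2.2.1.trans h.chromaticNumber_le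
  exact absurd this (by decide)

theorem min_col (hG : MinCex G) (s : Set V) (v : V) (hv : v ∉ s) : (G.induce s).Colorable 3 := by
  classical
  have h := hG.2.2.2 s (G.induce s) (Fintype.card_subtype_lt hv)
    (SimpleGraph.CliqueFree.comap ⟨(SimpleGraph.Embedding.induce s).toCopy⟩ hG.1)
    ⟨fun f => hG.2.1.false (f.trans (SimpleGraph.Embedding.induce s))⟩
  exact SimpleGraph.chromaticNumber_le_iff_colorable.1 h

theorem min_dom (hG : MinCex G) (u v : V) (huv : u ≠ v) : ∃ x, G.Adj u x ∧ ¬ G.Adj v x := by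
  classical
  by_contra hcon
  push Not at hcon
  obtain ⟨f⟩ := min_col hG {u}ᶜ u (by simp)
  refine min_not_col hG ⟨SimpleGraph.Coloring.mk
    (fun x => if h : x = u then f ⟨v, by simpa using huv.symm⟩ else f ⟨x, by simpa using h⟩) ?_⟩
  intro x y hxy
  by_cases hx : x = u <;> by_cases hy : y = u
  · subst hx hy; exact absurd hxy (G.irrefl)
  · subst hx
    simp only [dif_pos, hy, dif_neg, not_false_eq_true]
    exact f.valid (by simpa using hcon y hxy)
  · subst hy
    simp only [dif_pos, hx, dif_neg, not_false_eq_true]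
    exact f.valid (by simpa using (hcon x hxy.symm).symm)
  · simp only [hx, hy, dif_neg, not_false_eq_true]
    exact f.valid (by simpa using hxy)

theorem min_conn (hG : MinCex G) (u v : V) : G.Reachable u v := by
  classical
  by_contra hcon
  obtain ⟨f⟩ := min_col hG {x | G.Reachable u x} v hcon
  obtain ⟨g⟩ := min_col hG {x | ¬ G.Reachable u x} u (by simp)
  refine min_not_col hG ⟨SimpleGraph.Coloring.mk
    (fun x => if h : G.Reachable u x then f ⟨x, h⟩ else g ⟨x, h⟩) ?_⟩
  intro x y hxy
  by_cases hx : G.Reachable u x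
  · have hy : G.Reachable u y := hx.trans hxy.reachable
    simp only [hx, hy, dif_pos]
    exact f.valid (by simpa using hxy)
  · have hy : ¬ G.Reachable u y := fun hy => hx (hy.trans hxy.symm.reachable)
    simp only [hx, hy, dif_neg, not_false_eq_true]
    exact g.valid (by simpa using hxy)

/-- `u` is neither on nor adjacent to the cycle -/
def Far (G : SimpleGraph V) (d : Fin 5 → V) (u : V) : Prop := ∀ i, u ≠ d i ∧ ¬ G.Adj u (d i)

theorem far_iff (hG : MinCex G) (d : Fin 5 → V) (u : V) : 2 ≤ distC G d u ↔ Far G d u := by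
  unfold distC Far
  rw [Finset.le_inf'_iff]
  simp only [Finset.mem_univ, true_imp_iff]
  refine forall_congr' fun i => ?_
  constructor
  · intro h
    refine ⟨?_, fun ha => ?_⟩
    · rintro rfl
      simp at h
    · have := SimpleGraph.dist_eq_one_iff_adj.2 ha
      omega
  · rintro ⟨h1, h2⟩
    have h3 := (min_conn hG u (d i)).pos_dist_of_ne h1
    have h4 : G.dist u (d i) ≠ 1 := fun h => h2 (SimpleGraph.dist_eq_one_iff_adj.1 h)
    omega
end minimal
end ForkAux

namespace ForkAux
open SimpleGraph

/-- rows: cycle neighbourhoods of the ten node types -/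
def nb (p : Fin 10) (j : Fin 5) : Bool :=
  if p.val % 2 = 0 then decide (j.val = p.val % 5)
  else decide (j.val = (p.val + 1) % 5) || decide (j.val = (p.val + 4) % 5)

def zr : Fin 5 → Bool := fun _ => false

def ci (p : Fin 10) : Fin 5 := ⟨p.val % 5, Nat.mod_lt _ (by decide)⟩

section
variable {V : Type}

/-- off the cycle and with a prescribed neighbourhood on the cycle -/
def R (G : SimpleGraph V) (c : Fin 5 → V) (r : Fin 5 → Bool) (v : V) : Prop :=
  (∀ i, v ≠ c i) ∧ ∀ j, G.Adj v (c j) ↔ r j = true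

structure Ctx [Fintype V] (G : SimpleGraph V) (c : Fin 5 → V) : Prop where
  tf : ∀ a b c, G.Adj a b → G.Adj b c → G.Adj a c → False
  ff : ForkFree G
  c5 : IsC5 G c
  dom : ∀ u v, u ≠ v → ∃ x, G.Adj u x ∧ ¬ G.Adj v x
  Dind : ∀ u v, R G c zr u → R G c zr v → ¬ G.Adj u v
  good : ∀ d, IsC5 G d → (∀ u, Far G d u → Far G c u) → ∀ u, Far G c u → Far G d u

variable [Fintype V] {G : SimpleGraph V} {c : Fin 5 → V}

theorem Ctx.adj (h : Ctx G c) (i j : Fin 5) : G.Adj (c i) (c j) ↔ (j = i + 1 ∨ i = j + 1) := by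
  constructor
  · intro a
    by_contra hcon
    have : i = j ∨ j = i + 1 + 1 ∨ i = j + 1 + 1 := by clear * - hcon; revert i j; decide
    rcases this with rfl | rfl | rfl
    · exact G.irrefl a
    · exact h.tf _ _ _ (h.c5.2 i) (h.c5.2 (i + 1)) a
    · exact h.tf _ _ _ (h.c5.2 j) (h.c5.2 (j + 1)) a.symm
  · rintro (rfl | rfl)
    · exact h.c5.2 _
    · exact (h.c5.2 _).symm

/-- condition for the first fork lemma -/
def Cnd1 (r1 r2 r3 : Fin 5 → Bool) : Prop :=
  ∃ i e : Fin 5, (e = 1 ∨ e = 4) ∧ r1 i = true ∧ r2 i = true ∧ r1 (i + 2 * e) = false ∧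
    r2 (i + 2 * e) = false ∧ r3 i = false ∧ r3 (i + e) = false ∧ r3 (i - e) = false ∧
    r3 (i + 2 * e) = false

instance (r1 r2 r3) : Decidable (Cnd1 r1 r2 r3) := inferInstanceAs (Decidable (∃ _, _))

def Cnd2 (r1 r2 r3 : Fin 5 → Bool) : Prop :=
  ∃ i e : Fin 5, (e = 1 ∨ e = 4) ∧ r1 i = true ∧ r2 i = true ∧ r1 (i - 2 * e) = false ∧
    r2 (i - 2 * e) = false ∧ r3 (i + e) = true ∧ r3 i = false ∧ r3 (i - e) = false ∧
    r3 (i - 2 * e) = false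

instance (r1 r2 r3) : Decidable (Cnd2 r1 r2 r3) := inferInstanceAs (Decidable (∃ _, _))

theorem R.t {r : Fin 5 → Bool} {v : V} (h : R G c r v) {j : Fin 5} (e : r j = true) :
    G.Adj v (c j) := (h.2 j).2 e

theorem R.f {r : Fin 5 → Bool} {v : V} (h : R G c r v) {j : Fin 5} (e : r j = false) :
    ¬ G.Adj v (c j) := fun a => by
  have := (h.2 j).1 a
  rw [e] at this
  exact absurd this (by decide)

theorem Ctx.f1 (h : Ctx G c) {r1 r2 r3 : Fin 5 → Bool} {x y w : V} (hx : R G c r1 x)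
    (hy : R G c r2 y) (hw : R G c r3 w) (hc : Cnd1 r1 r2 r3) (a : G.Adj x w) : G.Adj y w := by
  obtain ⟨i, e, he, h1, h2, h3, h4, h5, h6, h7, h8⟩ := hc
  by_contra hcon
  refine no_fork h.tf h.ff (c i) y (c (i - e)) x w (c (i + e)) (c (i + 2 * e)) (hy.1 _)
    (hy.t h2).symm ?_ (hx.t h1).symm ?_ a ?_ (fun q => hcon q.symm) (hw.f h7) (hw.f h6)
    (fun q => hy.f h4 q.symm) ?_ (fun q => hx.f h3 q.symm) (hw.f h8)
  all_goals
    rw [h.adj]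
    clear * - he
    revert i e
    decide

theorem Ctx.f2 (h : Ctx G c) {r1 r2 r3 : Fin 5 → Bool} {x y w : V} (hx : R G c r1 x)
    (hy : R G c r2 y) (hw : R G c r3 w) (hc : Cnd2 r1 r2 r3) (hxy : x ≠ y) :
    G.Adj w x ∨ G.Adj w y := by
  obtain ⟨i, e, he, h1, h2, h3, h4, h5, h6, h7, h8⟩ := hc
  by_contra hcon
  rw [not_or] at hcon
  refine no_fork h.tf h.ff (c i) x y (c (i + e)) w (c (i - e)) (c (i - 2 * e)) hxy
    (hx.t h1).symm (hy.t h2).symm ?_ ?_ (hw.t h5).symm ?_ hcon.1 hcon.2 (hw.f h7)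
    (fun q => hx.f h3 q.symm) (fun q => hy.f h4 q.symm) ?_ (hw.f h8)
  all_goals
    rw [h.adj]
    clear * - he
    revert i e
    decide

/-- two vertices with a common neighbour on the cycle are not adjacent -/
theorem Ctx.sh (h : Ctx G c) {r1 r2 : Fin 5 → Bool} {x y : V} (hx : R G c r1 x)
    (hy : R G c r2 y) (hc : ∃ j, r1 j = true ∧ r2 j = true) : ¬ G.Adj x y := fun a => by
  obtain ⟨j, h1, h2⟩ := hc
  exact h.tf x y (c j) a (hy.t h2) (hx.t h1)

theorem Ctx.far (h : Ctx G c) (u : V) : Far G c u ↔ R G c zr u := by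
  unfold Far R zr
  simp only [Bool.false_eq_true, iff_false]
  exact forall_and

theorem row_cases : ∀ a0 a1 a2 a3 a4 : Bool,
    ((a0 && a1) || (a1 && a2) || (a2 && a3) || (a3 && a4) || (a4 && a0)) = false →
    ((∀ j, ![a0, a1, a2, a3, a4] j = zr j) ∨ ∃ p, ∀ j, ![a0, a1, a2, a3, a4] j = nb p j) := by
  decide

theorem Ctx.cover (h : Ctx G c) (v : V) (hv : ∀ i, v ≠ c i) : R G c zr v ∨ ∃ p, R G c (nb p) v := by
  classical
  have hcv : ∀ i, ¬ (G.Adj v (c i) ∧ G.Adj v (c (i + 1))) := fun i ⟨a, b⟩ =>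
    h.tf v (c i) (c (i + 1)) a (h.c5.2 i) b
  have e : ∀ j, G.Adj v (c j) ↔ (![decide (G.Adj v (c 0)), decide (G.Adj v (c 1)),
      decide (G.Adj v (c 2)), decide (G.Adj v (c 3)), decide (G.Adj v (c 4))] : Fin 5 → Bool) j
        = true := by
    intro j; fin_cases j <;> simp
  have := row_cases (decide (G.Adj v (c 0))) (decide (G.Adj v (c 1)))
      (decide (G.Adj v (c 2))) (decide (G.Adj v (c 3))) (decide (G.Adj v (c 4))) (by
    have q0 := hcv 0
    have q1 := hcv 1
    have q2 := hcv 2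
    have q3 := hcv 3
    have q4 := hcv 4
    simp only [Fin.isValue, zero_add, Fin.reduceAdd] at q0 q1 q2 q3 q4
    simp only [← Bool.decide_and, ← Bool.decide_or, decide_eq_false_iff_not, not_or]
    exact ⟨⟨⟨⟨q0, q1⟩, q2⟩, q3⟩, q4⟩)
  rcases this with h1 | ⟨p, h1⟩
  · exact Or.inl ⟨hv, fun j => by rw [e, h1]⟩
  · exact Or.inr ⟨p, hv, fun j => by rw [e, h1]⟩

theorem nb_inj : ∀ p q : Fin 10, (∀ j, nb p j = nb q j) → p = q := by decide

theorem R.uniq {p q : Fin 10} {v : V} (h1 : R G c (nb p) v) (h2 : R G c (nb q) v) : p = q :=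
  nb_inj p q fun j => by
    have := (h1.2 j).symm.trans (h2.2 j)
    exact Bool.eq_iff_iff.2 this

theorem R.nz {p : Fin 10} {v : V} (h1 : R G c (nb p) v) (h2 : R G c zr v) : False := by
  have : ∀ p, ∃ j, nb p j = true := by decide
  obtain ⟨j, hj⟩ := this p
  exact h2.f rfl (h1.t hj)

def gne (G : SimpleGraph V) (c : Fin 5 → V) (p : Fin 10) : Prop := ∃ x, R G c (nb p) x
def gE (G : SimpleGraph V) (c : Fin 5 → V) (p q : Fin 10) : Prop :=
  ∃ x y, R G c (nb p) x ∧ R G c (nb q) y ∧ G.Adj x y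
def gS (G : SimpleGraph V) (c : Fin 5 → V) (w : {w : V // R G c zr w}) (p : Fin 10) : Prop :=
  ∃ x, R G c (nb p) x ∧ G.Adj w x

theorem Ctx.uni (h : Ctx G c) {p q : Fin 10} (hpq : q = p ∨ q = p + 1 ∨ q = p - 1)
    {w : {w : V // R G c zr w}} (s : gS G c w p) {y : V} (hy : R G c (nb q) y) : G.Adj w y := by
  obtain ⟨x, hx, a⟩ := s
  exact (h.f1 hx hy w.2 (by clear * - hpq; revert p q; decide) a.symm).symm

theorem Ctx.lnk (h : Ctx G c) {p : Fin 10} (e : ev p) (l : gE G c p (p + 2)) {x y : V}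
    (hx : R G c (nb p) x) (hy : R G c (nb (p + 2)) y) : G.Adj x y := by
  obtain ⟨x', y', hx', hy', a⟩ := l
  have a1 : G.Adj x y' := h.f1 hx' hx hy' (by clear * - e; revert p; decide) a
  exact (h.f1 hy' hy hx (by clear * - e; revert p; decide) a1.symm).symm

theorem gE.symm {p q : Fin 10} (l : gE G c p q) : gE G c q p := by
  obtain ⟨x', y', hx', hy', a⟩ := l
  exact ⟨y', x', hy', hx', a.symm⟩

theorem Ctx.lnk' (h : Ctx G c) {p : Fin 10} (e : ev p) (l : gE G c p (p - 2)) {x y : V}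
    (hx : R G c (nb p) x) (hy : R G c (nb (p - 2)) y) : G.Adj x y := by
  refine (h.lnk (p := p - 2) (by clear * - e; revert p; decide) ?_ hy ?_).symm
  · rw [sub_add_cancel]; exact l.symm
  · rw [sub_add_cancel]; exact hx

/-- second fork lemma for nodes, one side -/
theorem Ctx.s2 (h : Ctx G c) {p a b : Fin 10} (e : ev p)
    (hab : (a = p + 4 ∧ b = p + 5) ∨ (a = p - 4 ∧ b = p + 5)) {x y w : V} (hw : R G c (nb p) w)
    (hx : R G c (nb a) x) (hy : R G c (nb b) y) : G.Adj w x ∨ G.Adj w y := by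
  refine h.f2 hx hy hw ?_ ?_
  · rcases hab with ⟨rfl, rfl⟩ | ⟨rfl, rfl⟩ <;> clear * - e <;> revert p <;> decide
  · rintro rfl
    have := hx.uniq hy
    clear * - hab this; revert p a b; decide

theorem Ctx.tri (h : Ctx G c) {w x y : V} (a : G.Adj w x) (b : G.Adj w y) : ¬ G.Adj x y :=
  fun d => h.tf w x y a d b

theorem Ctx.gd (h : Ctx G c) (w : {w : V // R G c zr w}) (p : Fin 10) (e : ¬ ev p)
    (s : gS G c w p) : gne G c (p + 5) := by
  classical
  by_contra hn
  obtain ⟨b, hb, ha⟩ := s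
  have up : ∀ j, j ≠ ci p → Function.update c (ci p) b j = c j := fun j hj =>
    Function.update_of_ne hj _ _
  have ui : Function.update c (ci p) b (ci p) = b := Function.update_self _ _ _
  have hd : IsC5 G (Function.update c (ci p) b) := by
    constructor
    · intro i j hij
      by_cases hi : i = ci p <;> by_cases hj : j = ci p
      · rw [hi, hj]
      · rw [hi, ui, up j hj] at hij
        exact absurd hij (hb.1 j)
      · rw [hj, ui, up i hi] at hij
        exact absurd hij.symm (hb.1 i)
      · rw [up i hi, up j hj] at hij
        exact h.c5.1 hij
    · intro i
      by_cases hi : i = ci p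
      · have hj : i + 1 ≠ ci p := by rw [hi]; simp
        rw [up _ hj, hi, ui]
        exact hb.t (by clear * - e; revert p; decide)
      · by_cases hj : i + 1 = ci p
        · rw [up _ hi, hj, ui]
          refine (hb.t ?_).symm
          have : i = ci p - 1 := by rw [← hj]; simp
          rw [this]
          clear * - e; revert p; decide
        · rw [up _ hi, up _ hj]
          exact h.c5.2 i
  have := h.good _ hd ?_ w ((h.far _).2 w.2) (ci p)
  · rw [ui] at this
    exact this.2 ha
  · intro u hu i
    have off : ∀ j, u ≠ c j := by
      intro j hj
      by_cases hji : j = ci p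
      · have := (hu (ci p + 1)).2
        rw [up _ (by simp), hj, hji] at this
        exact this (h.c5.2 _)
      · have := (hu j).1
        rw [up j hji] at this
        exact this hj
    refine ⟨off i, fun hadj => ?_⟩
    have non : ∀ j, j ≠ ci p → ¬ G.Adj u (c j) := by
      intro j hj
      have := (hu j).2
      rwa [up j hj] at this
    have hi : i = ci p := by
      by_contra hi
      exact non i hi hadj
    refine hn ⟨u, off, fun j => ?_⟩
    have hrow : nb (p + 5) j = true ↔ j = ci p := by clear * - e; revert p j; decide
    rw [hrow]
    constructor
    · intro hj
      by_contra hj'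
      exact non j hj' hj
    · rintro rfl
      rw [← hi]; exact hadj

theorem Ctx.nbr (h : Ctx G c) (w : {w : V // R G c zr w}) {x : V} (a : G.Adj w x) :
    ∃ q, R G c (nb q) x := by
  have off : ∀ i, x ≠ c i := by
    rintro i rfl
    exact w.2.f rfl a
  rcases h.cover x off with hx | hx
  · exact absurd a (h.Dind _ _ w.2 hx)
  · exact hx

theorem Ctx.abs (h : Ctx G c) : Abs (gne G c) (gE G c) (gS G c) where
  Ene := fun p q ⟨x, _, hx, _, _⟩ => ⟨x, hx⟩
  Esymm := fun p q l => l.symm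
  Epot := by
    rintro p q ⟨x, y, hx, hy, a⟩
    by_contra hn
    refine h.sh hx hy ?_ a
    clear * - hn; revert p q; decide
  Sne := fun w p ⟨x, hx, _⟩ => ⟨x, hx⟩
  Sadj1 := fun w p s ⟨y, hy⟩ => ⟨y, hy, h.uni (by simp) s hy⟩
  Sadj2 := fun w p s ⟨y, hy⟩ => ⟨y, hy, h.uni (by simp) s hy⟩
  SE := by
    rintro w p q ⟨x, y, hx, hy, a⟩ s1 s2
    exact h.tri (h.uni (by simp) s1 hx) (h.uni (by simp) s2 hy) a
  link1 := by
    rintro p e ⟨x, y, hx, hy, a⟩ ⟨z, hz⟩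
    have := h.f1 hx hz hy (by clear * - e; revert p; decide) a
    exact h.sh hz hy (by clear * - e; revert p; decide) this
  linkT := by
    rintro p e l1 ⟨y, z, hy, hz, a⟩ ⟨x, z', hx, hz', a'⟩
    have e2 : ev (p + 2) := by clear * - e; revert p; decide
    have q : p + 2 + 2 = p + 4 := by clear * -; revert p; decide
    have a2 := h.lnk e2 (by rw [q]; exact ⟨y, z, hy, hz, a⟩) hy (by rw [q]; exact hz')
    exact h.tf _ _ _ (h.lnk e l1 hx hy) a2 a'
  h1 := by
    intro p e l1 l2
    obtain ⟨_, v, _, hv, _⟩ := id l1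
    obtain ⟨_, u, _, hu, _⟩ := id l2
    constructor
    · rintro ⟨a, b, ha, hb, ab⟩
      have av := h.lnk e l1 ha hv
      have au := h.lnk' e l2 ha hu
      rcases h.s2 (p := p - 2) (a := p + 2) (b := p + 3) (by clear * - e; revert p; decide)
        (by clear * -; revert p; decide) hu hv hb with q | q
      · exact h.tri au av q
      · exact h.tri au ab q
    · rintro ⟨a, b, ha, hb, ab⟩
      have av := h.lnk e l1 ha hv
      have au := h.lnk' e l2 ha hu
      rcases h.s2 (p := p + 2) (a := p - 2) (b := p - 3) (by clear * - e; revert p; decide)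
        (by clear * -; revert p; decide) hv hu hb with q | q
      · exact h.tri av au q
      · exact h.tri av ab q
  h2 := by
    rintro p e l1 l2 ⟨s, hs⟩ ⟨t, ht⟩ ⟨⟨b, v, hb, hv, bv⟩, -⟩
    obtain ⟨a, u, ha, hu, -⟩ := id l2
    have av := h.lnk e l1 ha hv
    have au := h.lnk' e l2 ha hu
    have nab : ¬ G.Adj a b := fun q => h.tri q av bv
    have as := (h.s2 e (Or.inl ⟨rfl, rfl⟩) ha hs hb).resolve_right nab
    have at' := (h.s2 e (Or.inr ⟨rfl, rfl⟩) ha ht hb).resolve_right nab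
    refine no_fork h.tf h.ff a s v u (c (ci (p - 2))) t (c (ci (p - 4))) ?_ as av au at'
      (hu.t ?_) (ht.t ?_) (fun q => hs.f ?_ q.symm) (fun q => hv.f ?_ q.symm)
      (fun q => ht.f ?_ q.symm) (fun q => hs.f ?_ q.symm) (fun q => hv.f ?_ q.symm)
      (fun q => hu.f ?_ q.symm) ?_
    · rintro rfl
      have := hs.uniq hv
      clear * - this; revert p; decide
    all_goals try rw [h.adj]
    all_goals clear * - e; revert p; decide
  opp := by
    rintro w p e s1 s2
    obtain ⟨x, hx, wx⟩ := id s1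
    obtain ⟨z, hz, wz⟩ := id s2
    constructor
    · rintro ⟨y, hy⟩
      have wy : G.Adj w y := h.uni (by clear * -; revert p; decide) s2 hy
      rcases h.s2 e (Or.inl ⟨rfl, rfl⟩) hx hy hz with q | q
      · exact h.tri wx wy q
      · exact h.tri wx wz q
    · rintro ⟨y, hy⟩
      have wy : G.Adj w y := h.uni (by clear * -; revert p; decide) s2 hy
      rcases h.s2 e (Or.inr ⟨rfl, rfl⟩) hx hy hz with q | q
      · exact h.tri wx wy q
      · exact h.tri wx wz q
  e4 := by
    rintro w p e s1 s2
    obtain ⟨x, hx, wx⟩ := id s1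
    obtain ⟨y, hy, wy⟩ := id s2
    constructor
    · rintro ⟨z, hz⟩
      have wz : G.Adj w z := h.uni (by clear * -; revert p; decide) s1 hz
      rcases h.s2 (p := p + 4) (a := p) (b := p - 1) (by clear * - e; revert p; decide)
        (by clear * -; revert p; decide) hy hx hz with q | q
      · exact h.tri wy wx q
      · exact h.tri wy wz q
    · rintro ⟨z, hz⟩
      have wz : G.Adj w z := h.uni (by clear * -; revert p; decide) s2 hz
      rcases h.s2 e (Or.inl ⟨rfl, rfl⟩) hx hy hz with q | q
      · exact h.tri wx wy q
      · exact h.tri wx wz q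
  gd := fun w p => h.gd w p
  dom := by
    intro w p e
    obtain ⟨x, wx, cx⟩ := h.dom w (c (ci p)) (w.2.1 _)
    obtain ⟨q, hq⟩ := h.nbr w wx
    have : ¬ nb q (ci p) = true := fun t => cx (hq.t t).symm
    refine ⟨q, ⟨x, hq, wx⟩, ?_⟩
    clear * - e this; revert p q; decide
  inc := by
    intro w w' hww
    obtain ⟨x, wx, cx⟩ := h.dom w w' (fun q => hww (Subtype.ext q))
    obtain ⟨q, hq⟩ := h.nbr w wx
    exact ⟨q, ⟨x, hq, wx⟩, fun s => cx (h.uni (by simp) s hq)⟩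
end
end ForkAux

namespace ForkAux
open SimpleGraph
section
variable {V : Type} [Fintype V] {G : SimpleGraph V} {c : Fin 5 → V}

theorem Ctx.colorable (h : Ctx G c) (g : V → Fin 3) (cc : Fin 5 → Fin 3)
    (h1 : ∀ i, cc i ≠ cc (i + 1))
    (h2 : ∀ p v, R G c (nb p) v → ∀ j, nb p j = true → cc j ≠ g v)
    (h3 : ∀ p q x y, R G c (nb p) x → R G c (nb q) y → G.Adj x y → g x ≠ g y)
    (h4 : ∀ w, R G c zr w → ∀ p x, R G c (nb p) x → G.Adj w x → g w ≠ g x) :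
    G.Colorable 3 := by
  classical
  have hf : ∃ f : V → Fin 3, (∀ i, f (c i) = cc i) ∧ ∀ v, (∀ i, v ≠ c i) → f v = g v := by
    refine ⟨fun v => if hv : ∃ i, v = c i then cc hv.choose else g v, ?_, ?_⟩
    · intro i
      have hv : ∃ j, c i = c j := ⟨i, rfl⟩
      simp only [dif_pos hv]
      rw [← h.c5.1 hv.choose_spec]
    · intro v hv
      have : ¬ ∃ i, v = c i := fun ⟨i, hi⟩ => hv i hi
      simp only [dif_neg this]
  obtain ⟨f, f1, f2⟩ := hf
  have key : ∀ i v, G.Adj (c i) v → f (c i) ≠ f v := by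
    intro i v a
    by_cases hv : ∃ j, v = c j
    · obtain ⟨j, rfl⟩ := hv
      rw [f1, f1]
      rcases (h.adj i j).1 a with rfl | rfl
      · exact h1 _
      · exact (h1 _).symm
    · push Not at hv
      rw [f1, f2 v hv]
      rcases h.cover v hv with hz | ⟨p, hp⟩
      · exact absurd a.symm (hz.f rfl)
      · exact h2 p v hp i ((hp.2 i).1 a.symm)
  refine ⟨SimpleGraph.Coloring.mk f ?_⟩
  intro x y a
  by_cases hx : ∃ j, x = c j
  · obtain ⟨j, rfl⟩ := hx
    exact key _ _ a
  by_cases hy : ∃ j, y = c j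
  · obtain ⟨j, rfl⟩ := hy
    exact (key _ _ a.symm).symm
  push Not at hx hy
  rw [f2 x hx, f2 y hy]
  rcases h.cover x hx with hz | ⟨p, hp⟩
  · rcases h.cover y hy with hz' | ⟨q, hq⟩
    · exact absurd a (h.Dind _ _ hz hz')
    · exact h4 _ hz _ _ hq a
  · rcases h.cover y hy with hz' | ⟨q, hq⟩
    · exact (h4 _ hz' _ _ hp a.symm).symm
    · exact h3 _ _ _ _ hp hq a

def pos : Fin 5 → Fin 10 := ![0, 6, 2, 8, 4]

theorem Ctx.of_good (h : Ctx G c) (hg : Good (gne G c) (gE G c) (gS G c)) : G.Colorable 3 := by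
  classical
  obtain ⟨col, cc, g1, g2, g3, g4⟩ := hg
  choose k hk using g4
  have hgg : ∃ g : V → Fin 3, (∀ p v, R G c (nb p) v → g v = col p) ∧
      ∀ w (hw : R G c zr w), g w = k ⟨w, hw⟩ := by
    refine ⟨fun v => if hv : ∃ p, R G c (nb p) v then col hv.choose else
      if hw : R G c zr v then k ⟨v, hw⟩ else 0, ?_, ?_⟩
    · intro p v hp
      have hv : ∃ p, R G c (nb p) v := ⟨p, hp⟩
      simp only [dif_pos hv]
      rw [hp.uniq hv.choose_spec]
    · intro w hw
      have hv : ¬ ∃ p, R G c (nb p) w := fun ⟨p, hp⟩ => hp.nz hw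
      simp only [dif_neg hv, dif_pos hw]
  obtain ⟨g, e1, e2⟩ := hgg
  have ep : ∀ i, ev (pos i) := by decide
  refine h.colorable g (fun i => cc (pos i)) ?_ ?_ ?_ ?_
  · intro i
    have := g1 (pos (i + 1)) (ep _)
    rw [show pos (i + 1) + 4 = pos i by clear * -; revert i; decide] at this
    exact this.symm
  · intro p v hv j hj
    rw [e1 p v hv]
    have := g2 (pos j) (ep j)
    have hp : p = pos j ∨ p = pos j + 1 ∨ p = pos j - 1 := by clear * - hj; revert p j; decide
    rcases hp with rfl | rfl | rfl
    · exact this.1 ⟨v, hv⟩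
    · exact this.2.1 ⟨v, hv⟩
    · exact this.2.2 ⟨v, hv⟩
  · intro p q x y hx hy a
    rw [e1 p x hx, e1 q y hy]
    exact g3 p q ⟨x, y, hx, hy, a⟩
  · intro w hw p x hx a
    rw [e1 p x hx, e2 w hw]
    exact (hk ⟨w, hw⟩ p ⟨x, hx, a⟩).symm

/-- vertices of node 1 with neighbours in nodes 8 and 4 -/
def Dbl (G : SimpleGraph V) (c : Fin 5 → V) (b : V) : Prop :=
  R G c (nb 1) b ∧ (∃ x, R G c (nb 8) x ∧ G.Adj b x) ∧ ∃ y, R G c (nb 4) y ∧ G.Adj b y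

/-- vertices of node 4 with a neighbour of double type -/
def K0 (G : SimpleGraph V) (c : Fin 5 → V) (a : V) : Prop :=
  R G c (nb 4) a ∧ ∃ b, Dbl G c b ∧ G.Adj a b

def K1 (G : SimpleGraph V) (c : Fin 5 → V) (a : V) : Prop :=
  R G c (nb 4) a ∧ ¬ ∃ b, Dbl G c b ∧ G.Adj a b

def P1 (G : SimpleGraph V) (c : Fin 5 → V) (b : V) : Prop := ∃ a, K1 G c a ∧ G.Adj b a
def P7 (G : SimpleGraph V) (c : Fin 5 → V) (b : V) : Prop := ∃ a, K0 G c a ∧ G.Adj b a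

theorem Ctx.conf1 (h : Ctx G c) (hne : ∀ p, gne G c p) (hl : ¬ gE G c 8 0) {b2 x0 : V}
    (hb : R G c (nb 7) b2) (hx : R G c (nb 0) x0) (hP : P7 G c b2) : ¬ G.Adj b2 x0 := by
  intro bx
  obtain ⟨a, ⟨ha, b1, ⟨hb1, ⟨x3, hx3, b13⟩, -⟩, ab1⟩, ba⟩ := hP
  obtain ⟨b4, hb4⟩ := hne 9
  have nax : ¬ G.Adj a x0 := h.tri ba bx
  have ab4 : G.Adj a b4 :=
    (h.s2 (p := 4) (a := 0) (b := 9) (by decide) (by decide) ha hx hb4).resolve_left nax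
  exact no_fork h.tf h.ff a (c 4) b4 b1 x3 b2 x0 (fun q => hb4.1 _ q.symm) (ha.t (by decide)) ab4 ab1
    ba.symm b13 bx (hx3.f (by decide)) (h.sh hx3 hb4 (by decide)) (h.sh hx3 hb (by decide))
    (hx.f (by decide)) (h.sh hx hb4 (by decide)) (h.sh hx hb1 (by decide))
    (fun q => hl ⟨_, _, hx3, hx, q⟩)

theorem Ctx.conf2 (h : Ctx G c) (hne : ∀ p, gne G c p) (hl : ¬ gE G c 8 0) {b1 b2 : V}
    (hb1 : R G c (nb 1) b1) (hb2 : R G c (nb 7) b2) (hP1 : P1 G c b1) (hP : P7 G c b2) :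
    ¬ G.Adj b1 b2 := by
  intro bb
  obtain ⟨a1, ⟨ha1, hnd⟩, b1a⟩ := hP1
  obtain ⟨u0, hu⟩ := hne 0
  have nbu := h.conf1 hne hl hb2 hu hP
  obtain ⟨a, ⟨ha, d, ⟨hd, ⟨x3, hx3, d3⟩, -⟩, ad⟩, ba⟩ := hP
  exact no_fork h.tf h.ff (c 0) (c 4) u0 b1 b2 d x3 (fun q => hu.1 _ q.symm)
    ((h.adj _ _).2 (by decide)) (hu.t (by decide)).symm (hb1.t (by decide)).symm
    (hd.t (by decide)).symm bb d3 (hb2.f (by decide)) nbu (h.tri ba.symm ad)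
    (hx3.f (by decide)) (fun q => hl ⟨_, _, hx3, hu, q⟩)
    (fun q => hnd ⟨b1, ⟨hb1, ⟨x3, hx3, q.symm⟩, a1, ha1, b1a⟩, b1a.symm⟩)
    (h.sh hb2 hx3 (by decide))

theorem Ctx.special (h : Ctx G c) (hne : ∀ p, gne G c p) (hl : ∀ p, ev p → ¬ gE G c p (p + 2))
    (hW : ∀ w, ¬ R G c zr w) : G.Colorable 3 := by
  classical
  have hl8 : ¬ gE G c 8 0 := hl 8 (by decide)
  let base : Fin 10 → Fin 3 := ![2,0,1,1,0,0,0,0,2,2]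
  obtain ⟨g, e1, e4, e7, eb⟩ : ∃ g : V → Fin 3,
      (∀ v, R G c (nb 1) v → g v = if P1 G c v then 2 else 1) ∧
      (∀ v, R G c (nb 4) v → g v = if K0 G c v then 0 else 1) ∧
      (∀ v, R G c (nb 7) v → g v = if P7 G c v then 2 else 0) ∧
      (∀ p, p ≠ 1 → p ≠ 4 → p ≠ 7 → ∀ v, R G c (nb p) v → g v = base p) := by
    refine ⟨fun v => if hv : ∃ p, R G c (nb p) v then
      (if hv.choose = 1 then (if P1 G c v then 2 else 1) else
       if hv.choose = 4 then (if K0 G c v then 0 else 1) else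
       if hv.choose = 7 then (if P7 G c v then 2 else 0) else base hv.choose) else 0, ?_, ?_, ?_, ?_⟩
    · intro v hp
      have hv : ∃ p, R G c (nb p) v := ⟨_, hp⟩
      have := hv.choose_spec.uniq hp
      simp only [dif_pos hv, this, if_true]
    · intro v hp
      have hv : ∃ p, R G c (nb p) v := ⟨_, hp⟩
      have := hv.choose_spec.uniq hp
      simp only [dif_pos hv, this]
      rfl
    · intro v hp
      have hv : ∃ p, R G c (nb p) v := ⟨_, hp⟩
      have := hv.choose_spec.uniq hp
      simp only [dif_pos hv, this]
      rfl
    · intro p p1 p4 p7 v hp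
      have hv : ∃ p, R G c (nb p) v := ⟨_, hp⟩
      have := hv.choose_spec.uniq hp
      simp only [dif_pos hv, this, if_neg p1, if_neg p4, if_neg p7]
  have t1 : ∀ v, R G c (nb 1) v → g v = 1 ∨ g v = 2 := fun v hv => by
    rw [e1 v hv]; split <;> simp
  have t4 : ∀ v, R G c (nb 4) v → g v = 0 ∨ g v = 1 := fun v hv => by
    rw [e4 v hv]; split <;> simp
  have t7 : ∀ v, R G c (nb 7) v → g v = 0 ∨ g v = 2 := fun v hv => by
    rw [e7 v hv]; split <;> simp
  -- the set of possible colours of each node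
  let al : Fin 10 → Fin 3 → Bool := fun p k =>
    if p = 1 then (k = 1 || k = 2) else if p = 4 then (k = 0 || k = 1) else
    if p = 7 then (k = 0 || k = 2) else k = base p
  have hal : ∀ p v, R G c (nb p) v → al p (g v) = true := by
    intro p v hv
    by_cases p1 : p = 1
    · subst p1
      rcases t1 v hv with q | q <;> rw [q] <;> decide
    by_cases p4 : p = 4
    · subst p4
      rcases t4 v hv with q | q <;> rw [q] <;> decide
    by_cases p7 : p = 7
    · subst p7
      rcases t7 v hv with q | q <;> rw [q] <;> decide
    rw [eb p p1 p4 p7 v hv]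
    clear * - p1 p4 p7
    revert p; decide
  -- the delicate pairs
  have d14 : ∀ x y, R G c (nb 1) x → R G c (nb 4) y → G.Adj x y → g x ≠ g y := by
    intro x y hx hy a q
    rw [e1 x hx, e4 y hy] at q
    by_cases k : K0 G c y
    · rw [if_pos k] at q
      split at q <;> simp at q
    · have : P1 G c x := ⟨y, ⟨hy, fun hh => k ⟨hy, hh⟩⟩, a⟩
      rw [if_pos this, if_neg k] at q
      simp at q
  have d47 : ∀ x y, R G c (nb 4) x → R G c (nb 7) y → G.Adj x y → g x ≠ g y := by
    intro x y hx hy a q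
    rw [e4 x hx, e7 y hy] at q
    by_cases k : K0 G c x
    · have : P7 G c y := ⟨x, k, a.symm⟩
      rw [if_pos k, if_pos this] at q
      simp at q
    · rw [if_neg k] at q
      split at q <;> simp at q
  have d17 : ∀ x y, R G c (nb 1) x → R G c (nb 7) y → G.Adj x y → g x ≠ g y := by
    intro x y hx hy a q
    rw [e1 x hx, e7 y hy] at q
    by_cases k : P1 G c x
    · by_cases k' : P7 G c y
      · exact h.conf2 hne hl8 hx hy k k' a
      · rw [if_pos k, if_neg k'] at q
        simp at q
    · rw [if_neg k] at q
      split at q <;> simp at q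
  have d18 : ∀ x y, R G c (nb 1) x → R G c (nb 8) y → G.Adj x y → g x ≠ g y := by
    intro x y hx hy a q
    rw [e1 x hx, eb 8 (by decide) (by decide) (by decide) y hy] at q
    by_cases k : P1 G c x
    · obtain ⟨z, ⟨hz, hnd⟩, xz⟩ := k
      exact hnd ⟨x, ⟨hx, ⟨y, hy, a⟩, z, hz, xz⟩, xz.symm⟩
    · rw [if_neg k] at q
      exact absurd q (by decide)
  have d70 : ∀ x y, R G c (nb 7) x → R G c (nb 0) y → G.Adj x y → g x ≠ g y := by
    intro x y hx hy a q
    rw [e7 x hx, eb 0 (by decide) (by decide) (by decide) y hy] at q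
    by_cases k : P7 G c x
    · exact h.conf1 hne hl8 hx hy k a
    · rw [if_neg k] at q
      exact absurd q (by decide)
  have comb : ∀ p q : Fin 10, pot p q → (∀ k, al p k = true → al q k = true → False) ∨
      (ev p ∧ q = p + 2) ∨ (ev q ∧ p = q + 2) ∨
      (p = 1 ∧ q = 4) ∨ (p = 4 ∧ q = 1) ∨ (p = 4 ∧ q = 7) ∨ (p = 7 ∧ q = 4) ∨
      (p = 1 ∧ q = 7) ∨ (p = 7 ∧ q = 1) ∨ (p = 1 ∧ q = 8) ∨ (p = 8 ∧ q = 1) ∨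
      (p = 7 ∧ q = 0) ∨ (p = 0 ∧ q = 7) := by
    clear * -
    decide
  refine h.colorable g ![0, 1, 0, 1, 2] (by decide) ?_ ?_ (fun w hw => absurd hw (hW w))
  · intro p v hv j hj q
    have := hal p v hv
    rw [← q] at this
    clear * - this hj
    revert p j; decide
  · intro p q x y hx hy a
    rcases comb p q (h.abs.Epot _ _ ⟨x, y, hx, hy, a⟩) with t | ⟨e, rfl⟩ | ⟨e, rfl⟩ | t
    · intro hxy
      exact t (g x) (hal p x hx) (hxy ▸ hal q y hy)
    · exact absurd ⟨x, y, hx, hy, a⟩ (hl p e)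
    · exact absurd ⟨y, x, hy, hx, a.symm⟩ (hl q e)
    · rcases t with ⟨rfl, rfl⟩ | ⟨rfl, rfl⟩ | ⟨rfl, rfl⟩ | ⟨rfl, rfl⟩ | ⟨rfl, rfl⟩ | ⟨rfl, rfl⟩ |
        ⟨rfl, rfl⟩ | ⟨rfl, rfl⟩ | ⟨rfl, rfl⟩ | ⟨rfl, rfl⟩
      · exact d14 _ _ hx hy a
      · exact (d14 _ _ hy hx a.symm).symm
      · exact d47 _ _ hx hy a
      · exact (d47 _ _ hy hx a.symm).symm
      · exact d17 _ _ hx hy a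
      · exact (d17 _ _ hy hx a.symm).symm
      · exact d18 _ _ hx hy a
      · exact (d18 _ _ hy hx a.symm).symm
      · exact d70 _ _ hx hy a
      · exact (d70 _ _ hy hx a.symm).symm

theorem Ctx.final (h : Ctx G c) : G.Colorable 3 := by
  rcases abs_main h.abs with hg | ⟨h1, h2, h3⟩
  · exact h.of_good hg
  · exact h.special h1 h2 fun w hw => h3.false ⟨w, hw⟩
end
end ForkAux

theorem minCex_second_nbhd_not_independent {V : Type} [Fintype V]
    (G : SimpleGraph V) (hG : MinCex G) (c : Fin 5 → V) (hc : GoodC5 G c)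
    (h3 : ∀ u : V, distC G c u < 3) :
    ∃ x y : V, distC G c x = 2 ∧ distC G c y = 2 ∧ G.Adj x y := by
  by_contra hcon
  push Not at hcon
  have hz : ∀ u, ForkAux.R G c ForkAux.zr u → distC G c u = 2 := by
    intro u hu
    have h2 : 2 ≤ distC G c u :=
      (ForkAux.far_iff hG c u).2 fun i => ⟨hu.1 i, hu.f rfl⟩
    have := h3 u
    omega
  refine ForkAux.min_not_col hG (ForkAux.Ctx.final (c := c) ?_)
  refine ⟨ForkAux.min_tf hG, hG.2.1, hc.1, ForkAux.min_dom hG,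
    fun u v hu hv => hcon u v (hz u hu) (hz v hv), ?_⟩
  intro d hd hsub u hu
  have hle := hc.2 d hd
  simp only [ForkAux.far_iff hG] at hle
  have heq : {u | ForkAux.Far G d u} = {u | ForkAux.Far G c u} :=
    Set.eq_of_subset_of_ncard_le (fun u hu => hsub u hu) hle (Set.toFinite _)
  have : u ∈ {u | ForkAux.Far G d u} := by rw [heq]; exact hu
  exact this
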